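/- arXiv:1903.00311 — 5 statements merged into one kernel-verified Lean document; each statement's English description precedes it below -/
import Mathlib

section
/- Let ω ∈ (0,1) be irrational and (C,τ)-Diophantine with 0 < C ≤ 1 and τ > 1, and let Δ ∈ (0, min(τ^{−1}, τ e^{−1})]. Then 𝔅rj₂(Δ) ≤ (C^{−1}(τ−1)(τ e^{−1})^τ / log φ) · Δ^{−τ} · ( log²(Δ^{−1}) + G⁽¹⁾ log(Δ^{−1}) + G⁽⁰⁾ ), where G⁽¹⁾ = log(C^{−1})/(τ−1) + Γ_Eul(τ)/(2(τ e^{−1})^τ) + log(3φ(τ+1)²) and G⁽⁰⁾ = (log(C^{−1})/(τ−1)) · ( log(3τφ) + Γ_Eul(τ)/(2(τ e^{−1})^τ) ) + log(3φ(τ+1)) · log(τ+1) + Λ(τ)/(τ e^{−1})^τ. -/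
open Real
open scoped ENNReal

noncomputable section

/-- The Gauss-map iterates of `ω`. -/
def cfX (ω : ℝ) : ℕ → ℝ
  | 0 => ω
  | n + 1 => Int.fract (cfX ω n)⁻¹

/-- The partial quotients of `ω`: for `n ≥ 1`, `cfA ω n = ⌊1 / x_{n-1}⌋`. -/
def cfA (ω : ℝ) : ℕ → ℕ
  | 0 => 0
  | n + 1 => (⌊(cfX ω n)⁻¹⌋).toNat

/-- Denominators of the convergents of `ω`. -/
def cfQ (ω : ℝ) : ℕ → ℕ
  | 0 => 1
  | 1 => cfA ω 1
  | n + 2 => cfA ω (n + 2) * cfQ ω (n + 1) + cfQ ω n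

/-- Second Brjuno-like function `𝔅rj₂(Δ) = Σ_{n=1}^∞ e^{-q_n Δ} q_{n+1} log a_{n+1}`. -/
def Brj2 (ω Δ : ℝ) : ℝ≥0∞ :=
  ∑' n : ℕ, ENNReal.ofReal
    (Real.exp (-(cfQ ω (n + 1) : ℝ) * Δ) * (cfQ ω (n + 2) : ℝ) * Real.log (cfA ω (n + 2) : ℝ))

/-- `ω` is `(C,τ)`-Diophantine: `|qω - p| ≥ C/|q|^τ` for all integers `p`, `q ≠ 0`. -/
def IsDiophantine (C τ ω : ℝ) : Prop :=
  ∀ p q : ℤ, q ≠ 0 → C / |(q : ℝ)| ^ τ ≤ |(q : ℝ) * ω - (p : ℝ)|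

/-- The golden ratio `φ = (1+√5)/2`. -/
def goldenφ : ℝ := (1 + Real.sqrt 5) / 2

/-- `Λ(s) = ∫_0^∞ e^{-y} y^{s-1} |log y| dy`. -/
def LambdaInt (s : ℝ) : ℝ := ∫ y in Set.Ioi (0 : ℝ), Real.exp (-y) * y ^ (s - 1) * |Real.log y|

end

open MeasureTheory Set

lemma ofReal_log_mul_ofReal_le_lintegral {F : ℝ → ℝ} {a r : ℝ} (ha0 : 0 < a) (hr : 1 ≤ r)
    (hanti : AntitoneOn F (Icc a (r * a))) (hF0 : 0 ≤ F (r * a)) :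
    ENNReal.ofReal (log r) * ENNReal.ofReal (F (r * a)) ≤
      ∫⁻ x in Ioc a (r * a), ENNReal.ofReal (F x / x) := by
  have hab : a ≤ r * a := le_mul_of_one_le_left ha0.le hr
  have hint : ∫ x in a..(r * a), F (r * a) / x = F (r * a) * log r := by
    simp only [div_eq_mul_inv]
    rw [intervalIntegral.integral_const_mul, integral_inv_of_pos ha0 (ha0.trans_le hab),
      mul_div_assoc, div_self ha0.ne', mul_one]
  have hii : IntegrableOn (fun x => F (r * a) / x) (Ioc a (r * a)) := by
    rw [← intervalIntegrable_iff_integrableOn_Ioc_of_le hab]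
    apply ContinuousOn.intervalIntegrable
    rw [uIcc_of_le hab]
    exact continuousOn_const.div continuousOn_id fun x hx => (ha0.trans_le hx.1).ne'
  calc ENNReal.ofReal (log r) * ENNReal.ofReal (F (r * a))
      = ENNReal.ofReal (F (r * a) * log r) := by
        rw [← ENNReal.ofReal_mul (log_nonneg hr), mul_comm]
    _ = ∫⁻ x in Ioc a (r * a), ENNReal.ofReal (F (r * a) / x) := by
        rw [← hint, intervalIntegral.integral_of_le hab]
        apply ofReal_integral_eq_lintegral_ofReal hii
        filter_upwards [ae_restrict_mem measurableSet_Ioc] with x hx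
        exact div_nonneg hF0 (ha0.trans hx.1).le
    _ ≤ _ := by
        apply setLIntegral_mono' measurableSet_Ioc
        intro x hx
        apply ENNReal.ofReal_le_ofReal
        have hx0 := ha0.trans hx.1
        exact div_le_div_of_nonneg_right
          (hanti ⟨hx.1.le, hx.2⟩ (right_mem_Icc.mpr hab) hx.2) hx0.le

lemma goldenRatio_count_le {Q : ℕ → ℝ} (hQpow : ∀ k, goldenRatio ^ k ≤ Q k) {X : ℝ} (hX : 1 ≤ X)
    {m : ℕ} (hmin : ∀ k < m, Q k ≤ X) :
    (m : ℝ) * log goldenRatio ≤ log goldenRatio + log X := by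
  have hφ0 := goldenRatio_pos
  rcases m with _ | k
  · simpa using add_nonneg (log_pos one_lt_goldenRatio).le (log_nonneg hX)
  · have h := (hQpow k).trans (hmin k (Nat.lt_succ_self k))
    have := log_le_log (by positivity) h
    rw [log_pow] at this
    push_cast
    linarith

lemma goldenRatio_pow_mul_le {Q : ℕ → ℝ} (hmono : Monotone Q)
    (hadd : ∀ k, Q (k + 1) + Q k ≤ Q (k + 2)) {X : ℝ} (hX : 0 ≤ X) {m : ℕ} (hm : X ≤ Q m)
    (j : ℕ) :
    goldenRatio ^ j * X ≤ Q (m + 1 + j) ∧ goldenRatio ^ (j + 1) * X ≤ Q (m + 1 + (j + 1)) := by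
  induction j with
  | zero =>
    have h1 : X ≤ Q (m + 1) := hm.trans (hmono (Nat.le_succ m))
    have h2 := hadd m
    have h3 := goldenRatio_lt_two
    constructor
    · simpa using h1
    · simp only [zero_add, pow_one]
      rw [show m + 1 + 1 = m + 2 from rfl]
      nlinarith
  | succ j ih =>
    refine ⟨ih.2, ?_⟩
    have h2 := hadd (m + 1 + j)
    have h3 : goldenRatio ^ (j + 1 + 1) * X =
        goldenRatio ^ (j + 1) * X + goldenRatio ^ j * X := by
      rw [pow_succ, pow_succ]
      linear_combination goldenRatio ^ j * X * goldenRatio_sq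
    rw [h3]
    calc _ ≤ Q (m + 1 + j + 1) + Q (m + 1 + j) := add_le_add ih.2 ih.1
      _ ≤ _ := h2

lemma sum_ofReal_le_of_antitoneOn {Q : ℕ → ℝ} (hQ1 : ∀ k, 1 ≤ Q k)
    (hQpow : ∀ k, goldenRatio ^ k ≤ Q k) (hmono : Monotone Q)
    (hadd : ∀ k, Q (k + 1) + Q k ≤ Q (k + 2))
    {F : ℝ → ℝ} {X M I : ℝ} (hX : 1 ≤ X) (hM : ∀ x, 1 ≤ x → x ≤ X → F x ≤ M) (hM0 : 0 ≤ M)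
    (hanti : AntitoneOn F (Ici X)) (hF0 : ∀ x, X ≤ x → 0 ≤ F x) (hI0 : 0 ≤ I)
    (hI : ∫⁻ x in Ioi X, ENNReal.ofReal (F x / x) ≤ ENNReal.ofReal I) :
    ∑' k, ENNReal.ofReal (F (Q k)) ≤
      ENNReal.ofReal ((M * log (3 * goldenRatio * X) + I) / log goldenRatio) := by
  have hφ1 := one_lt_goldenRatio
  have hφ0 := goldenRatio_pos
  have hlog : 0 < log goldenRatio := log_pos hφ1
  have hX0 : 0 < X := by linarith
  have hex : ∃ k, X < Q k := by
    obtain ⟨k, hk⟩ := pow_unbounded_of_one_lt X hφ1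
    exact ⟨k, hk.trans_le (hQpow k)⟩
  classical
  obtain ⟨m, hm, hmin⟩ : ∃ m, X < Q m ∧ ∀ k < m, Q k ≤ X :=
    ⟨Nat.find hex, Nat.find_spec hex, fun k hk => not_lt.mp (Nat.find_min hex hk)⟩
  have hcount := goldenRatio_count_le hQpow hX hmin
  have hgrow := goldenRatio_pow_mul_le hmono hadd hX0.le hm.le
  have hpowX : ∀ j : ℕ, X ≤ goldenRatio ^ j * X := fun j =>
    le_mul_of_one_le_left hX0.le (one_le_pow₀ hφ1.le)
  have hhead : ∀ k < m + 2, F (Q k) ≤ M := by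
    intro k hk
    rcases lt_or_ge k m with h | h
    · exact hM _ (hQ1 k) (hmin k h)
    · have hXk : X ≤ Q k := hm.le.trans (hmono h)
      exact (hanti self_mem_Ici hXk hXk).trans (hM X hX le_rfl)
  have hstep : ∀ j : ℕ, ENNReal.ofReal (log goldenRatio) * ENNReal.ofReal (F (Q (j + (m + 2)))) ≤
      ∫⁻ x in Ioc (goldenRatio ^ j * X) (goldenRatio ^ (j + 1) * X), ENNReal.ofReal (F x / x) := by
    intro j
    have ha0 : 0 < goldenRatio ^ j * X := by positivity
    have hbX := hpowX (j + 1)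
    have hQb : goldenRatio ^ (j + 1) * X ≤ Q (j + (m + 2)) := by
      have := (hgrow j).2
      rwa [show m + 1 + (j + 1) = j + (m + 2) by ring] at this
    have hFb := hanti hbX (hbX.trans hQb) hQb
    have hb : goldenRatio ^ (j + 1) * X = goldenRatio * (goldenRatio ^ j * X) := by ring
    refine (mul_le_mul_right (ENNReal.ofReal_le_ofReal hFb) _).trans ?_
    rw [hb] at hbX ⊢
    exact ofReal_log_mul_ofReal_le_lintegral ha0 hφ1.le
      (hanti.mono fun x hx => (hpowX j).trans hx.1) (hF0 _ hbX)
  have hpm : Monotone fun j : ℕ => goldenRatio ^ j * X := fun i j hij =>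
    mul_le_mul_of_nonneg_right (pow_le_pow_right₀ hφ1.le hij) hX0.le
  have htail : ENNReal.ofReal (log goldenRatio) * ∑' j, ENNReal.ofReal (F (Q (j + (m + 2)))) ≤
      ENNReal.ofReal I := by
    rw [← ENNReal.tsum_mul_left]
    refine (ENNReal.tsum_le_tsum hstep).trans ?_
    have hdisj := hpm.pairwise_disjoint_on_Ioc_succ
    simp only [Order.succ_eq_add_one] at hdisj
    rw [← lintegral_iUnion (fun _ => measurableSet_Ioc) hdisj]
    refine (lintegral_mono_set ?_).trans hI
    exact iUnion_subset fun j x hx => (hpowX j).trans_lt hx.1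
  have htail' : ∑' j, ENNReal.ofReal (F (Q (j + (m + 2)))) ≤
      ENNReal.ofReal (I / log goldenRatio) := by
    rw [ENNReal.ofReal_div_of_pos hlog, ENNReal.le_div_iff_mul_le (Or.inl (by simpa using hlog))
      (Or.inl ENNReal.ofReal_ne_top), mul_comm]
    exact htail
  have hheadsum : ∑ k ∈ Finset.range (m + 2), ENNReal.ofReal (F (Q k)) ≤
      ENNReal.ofReal (((m : ℝ) + 2) * M) := by
    refine (Finset.sum_le_card_nsmul _ _ (ENNReal.ofReal M) fun k hk =>
      ENNReal.ofReal_le_ofReal (hhead k (Finset.mem_range.mp hk))).trans ?_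
    have hcast : ((m : ℝ) + 2) = ((m + 2 : ℕ) : ℝ) := by push_cast; ring
    rw [Finset.card_range, nsmul_eq_mul, hcast, ENNReal.ofReal_mul (Nat.cast_nonneg _),
      ENNReal.ofReal_natCast]
  have hlog3 : 2 * log goldenRatio ≤ log 3 := by
    have h : goldenRatio ^ 2 ≤ 3 := by
      rw [goldenRatio_sq]
      linarith [goldenRatio_lt_two]
    have := log_le_log (by positivity) h
    rwa [log_pow] at this
  rw [← (ENNReal.summable (f := fun k => ENNReal.ofReal (F (Q (k + (m + 2)))))).sum_add_tsum_nat_add'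
    (f := fun k => ENNReal.ofReal (F (Q k)))]
  refine (add_le_add hheadsum htail').trans ?_
  rw [← ENNReal.ofReal_add (by positivity) (by positivity), add_div]
  apply ENNReal.ofReal_le_ofReal
  have hcoef : ((m : ℝ) + 2) * log goldenRatio ≤ log (3 * goldenRatio * X) := by
    rw [log_mul (by positivity) (by positivity), log_mul (by positivity) (by positivity)]
    linarith
  refine add_le_add ?_ le_rfl
  rw [le_div_iff₀ hlog]
  calc ((m : ℝ) + 2) * M * log goldenRatio = M * (((m : ℝ) + 2) * log goldenRatio) := by ring
    _ ≤ _ := mul_le_mul_of_nonneg_left hcoef hM0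

lemma rpow_mul_exp_neg_antitoneOn {s Δ : ℝ} (hs : 0 < s) (hΔ : 0 < Δ) :
    AntitoneOn (fun x : ℝ => exp (-x * Δ) * x ^ s) (Ici (s / Δ)) := by
  intro x hx y hy hxy
  have hx0 : 0 < x := (div_pos hs hΔ).trans_le hx
  have hy0 : 0 < y := hx0.trans_le hxy
  have hsx : s ≤ x * Δ := (div_le_iff₀ hΔ).mp hx
  simp only [rpow_def_of_pos hx0, rpow_def_of_pos hy0, ← exp_add]
  apply exp_le_exp.mpr
  have h := log_le_sub_one_of_pos (div_pos hy0 hx0)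
  rw [log_div hy0.ne' hx0.ne'] at h
  have h2 : s * (y / x - 1) ≤ (y - x) * Δ := by
    have : y / x - 1 = (y - x) / x := by field_simp
    rw [this, mul_div_assoc', div_le_iff₀ hx0]
    nlinarith
  nlinarith

lemma rpow_mul_exp_neg_le {s Δ x : ℝ} (hs : 0 < s) (hΔ : 0 < Δ) (hx : 0 < x) :
    exp (-x * Δ) * x ^ s ≤ (s * exp (-1)) ^ s * Δ ^ (-s) := by
  rw [rpow_def_of_pos hx, rpow_def_of_pos hΔ, rpow_def_of_pos (by positivity), ← exp_add,
    ← exp_add, log_mul hs.ne' (exp_ne_zero _), log_exp]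
  apply exp_le_exp.mpr
  have h := log_le_sub_one_of_pos (show 0 < x * Δ / s by positivity)
  rw [log_div (by positivity) hs.ne', log_mul hx.ne' hΔ.ne'] at h
  have h2 : s * (x * Δ / s) = x * Δ := by field_simp
  nlinarith

/-- The median of the Gamma distribution of shape `s` is at most `s`. -/
lemma integral_Ioi_self_le_half_Gamma {s : ℝ} (hs : 0 < s) :
    ∫ y in Ioi s, exp (-y) * y ^ (s - 1) ≤ Gamma s / 2 := by
  have hG := GammaIntegral_convergent hs
  have hI1 : IntegrableOn (fun y : ℝ => exp (-y) * y ^ (s - 1)) (Ioi s) :=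
    hG.mono_set (Ioi_subset_Ioi hs.le)
  have hI2 : IntegrableOn (fun y : ℝ => exp (-y) * y ^ (s - 1)) (Ioo 0 s) :=
    hG.mono_set Ioo_subset_Ioi_self
  have himg : (fun x : ℝ => s ^ 2 / x) '' Ioo 0 s = Ioi s := by
    ext y
    constructor
    · rintro ⟨x, ⟨hx0, hxs⟩, rfl⟩
      rw [mem_Ioi, lt_div_iff₀ hx0]
      nlinarith
    · intro hy
      have hy' : s < y := hy
      have hy0 : 0 < y := hs.trans hy'
      refine ⟨s ^ 2 / y, ⟨by positivity, ?_⟩, ?_⟩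
      · rw [div_lt_iff₀ hy0]
        nlinarith
      · dsimp only
        field_simp
  have hderiv : ∀ x ∈ Ioo 0 s, HasDerivWithinAt (fun x : ℝ => s ^ 2 / x) (-(s ^ 2 / x ^ 2))
      (Ioo 0 s) x := by
    intro x hx
    have := ((hasDerivAt_inv hx.1.ne').const_mul (s ^ 2)).hasDerivWithinAt (s := Ioo 0 s)
    simp only [← div_eq_mul_inv] at this
    exact this.congr_deriv (by rw [mul_neg, ← div_eq_mul_inv])
  have hinj : InjOn (fun x : ℝ => s ^ 2 / x) (Ioo 0 s) := by
    intro x hx y hy h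
    have hx0 := hx.1
    have hy0 := hy.1
    dsimp only at h
    rw [div_eq_div_iff hx0.ne' hy0.ne'] at h
    exact (mul_left_cancel₀ (by positivity) h).symm
  have hle : ∫ y in Ioi s, exp (-y) * y ^ (s - 1) ≤ ∫ y in Ioo 0 s, exp (-y) * y ^ (s - 1) := by
    have hcv := integral_image_eq_integral_abs_deriv_smul measurableSet_Ioo hderiv hinj
      (fun y : ℝ => exp (-y) * y ^ (s - 1))
    have hic := (integrableOn_image_iff_integrableOn_abs_deriv_smul measurableSet_Ioo hderiv hinj
      (fun y : ℝ => exp (-y) * y ^ (s - 1))).mp (by rwa [himg])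
    rw [himg] at hcv
    rw [hcv]
    refine setIntegral_mono_on hic hI2 measurableSet_Ioo ?_
    rintro x ⟨hx0, hxs⟩
    have ht : 1 ≤ s / x := (one_le_div hx0).mpr hxs.le
    have hsinh := self_le_sinh_iff.mpr (log_nonneg ht)
    rw [sinh_log (by positivity), log_div hs.ne' hx0.ne', inv_div] at hsinh
    have hm : s * (s / x - x / s) = s ^ 2 / x - x := by field_simp
    have key : exp (-(s ^ 2 / x)) * (s ^ 2 / x) ^ s ≤ exp (-x) * x ^ s := by
      rw [rpow_def_of_pos hx0, rpow_def_of_pos (by positivity), ← exp_add, ← exp_add,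
        log_div (by positivity) hx0.ne', log_pow]
      apply exp_le_exp.mpr
      push_cast
      nlinarith
    rw [abs_neg, abs_of_nonneg (by positivity), smul_eq_mul, rpow_sub_one (by positivity),
      rpow_sub_one hx0.ne']
    calc s ^ 2 / x ^ 2 * (exp (-(s ^ 2 / x)) * ((s ^ 2 / x) ^ s / (s ^ 2 / x)))
        = (exp (-(s ^ 2 / x)) * (s ^ 2 / x) ^ s) / x := by field_simp
      _ ≤ (exp (-x) * x ^ s) / x := by gcongr
      _ = _ := by ring
  have hsplit : Gamma s = (∫ y in Ioc 0 s, exp (-y) * y ^ (s - 1)) +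
      ∫ y in Ioi s, exp (-y) * y ^ (s - 1) := by
    rw [Gamma_eq_integral hs, ← Ioc_union_Ioi_eq_Ioi hs.le,
      setIntegral_union (Ioc_disjoint_Ioi le_rfl) measurableSet_Ioi
        (hG.mono_set Ioc_subset_Ioi_self) hI1]
  rw [integral_Ioc_eq_integral_Ioo] at hsplit
  linarith

lemma integrableOn_exp_neg_mul_rpow_mul_abs_log {s : ℝ} (hs : 1 < s) :
    IntegrableOn (fun y : ℝ => exp (-y) * y ^ (s - 1) * |log y|) (Ioi 0) := by
  have h1 := GammaIntegral_convergent (show 0 < s + 1 by linarith)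
  have h2 := GammaIntegral_convergent (show 0 < s - 1 by linarith)
  refine Integrable.mono' (h1.add h2) ?_ ?_
  · exact Measurable.aestronglyMeasurable (by fun_prop)
  · filter_upwards [ae_restrict_mem measurableSet_Ioi] with y hy
    have hy0 : 0 < y := hy
    have hlog : |log y| ≤ y + y⁻¹ := by
      have ha := log_le_sub_one_of_pos hy0
      have hb := log_le_sub_one_of_pos (inv_pos.mpr hy0)
      rw [log_inv] at hb
      have hc := inv_pos.mpr hy0
      rw [abs_le]
      constructor <;> linarith
    rw [norm_of_nonneg (by positivity)]
    calc exp (-y) * y ^ (s - 1) * |log y| ≤ exp (-y) * y ^ (s - 1) * (y + y⁻¹) := by gcongr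
      _ = _ := by
        simp only [Pi.add_apply]
        rw [show s + 1 - 1 = (s - 1) + 1 by ring, rpow_add_one hy0.ne', rpow_sub_one hy0.ne' (s - 1)]
        ring

section Denominators

variable {ω : ℝ}

lemma cfX_irrational (hirr : Irrational ω) (n : ℕ) : Irrational (cfX ω n) := by
  induction n with
  | zero => exact hirr
  | succ n ih =>
    have h : Irrational (cfX ω n)⁻¹ := irrational_inv_iff.mpr ih
    exact h.sub_intCast ⌊(cfX ω n)⁻¹⌋

lemma cfX_mem_Ioo (hirr : Irrational ω) (hω0 : 0 < ω) (hω1 : ω < 1) (n : ℕ) :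
    cfX ω n ∈ Ioo (0 : ℝ) 1 := by
  cases n with
  | zero => exact ⟨hω0, hω1⟩
  | succ n =>
    have h := (cfX_irrational hirr (n + 1)).ne_zero
    exact ⟨lt_of_le_of_ne (Int.fract_nonneg _) h.symm, Int.fract_lt_one _⟩

lemma cfA_add_cfX (hirr : Irrational ω) (hω0 : 0 < ω) (hω1 : ω < 1) (n : ℕ) :
    (cfA ω (n + 1) : ℝ) + cfX ω (n + 1) = (cfX ω n)⁻¹ := by
  have hx := cfX_mem_Ioo hirr hω0 hω1 n
  have h0 : 0 ≤ ⌊(cfX ω n)⁻¹⌋ := Int.floor_nonneg.mpr (inv_nonneg.mpr hx.1.le)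
  have hc : (cfA ω (n + 1) : ℝ) = (⌊(cfX ω n)⁻¹⌋ : ℝ) := by
    rw [← Int.toNat_of_nonneg h0]
    rfl
  rw [hc]
  exact Int.floor_add_fract _

lemma one_le_cfA (hirr : Irrational ω) (hω0 : 0 < ω) (hω1 : ω < 1) (n : ℕ) :
    1 ≤ cfA ω (n + 1) := by
  have hx := cfX_mem_Ioo hirr hω0 hω1 n
  have h1 : 1 ≤ ⌊(cfX ω n)⁻¹⌋ :=
    Int.le_floor.mpr (by simpa using (one_lt_inv₀ hx.1).mpr hx.2 |>.le)
  change 1 ≤ (⌊(cfX ω n)⁻¹⌋).toNat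
  omega

lemma one_le_cfQ (hirr : Irrational ω) (hω0 : 0 < ω) (hω1 : ω < 1) (n : ℕ) : 1 ≤ cfQ ω n := by
  induction n using Nat.strong_induction_on with
  | _ n ih =>
    match n with
    | 0 => exact le_rfl
    | 1 => exact one_le_cfA hirr hω0 hω1 0
    | k + 2 => exact (ih k (by omega)).trans (Nat.le_add_left _ _)

lemma cfQ_add_le (hirr : Irrational ω) (hω0 : 0 < ω) (hω1 : ω < 1) (n : ℕ) :
    cfQ ω (n + 1) + cfQ ω n ≤ cfQ ω (n + 2) :=
  Nat.add_le_add_right (Nat.le_mul_of_pos_left _ (one_le_cfA hirr hω0 hω1 (n + 1))) _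

/-- Numerators of the convergents of a number in `(0, 1)`. -/
noncomputable def cfP (ω : ℝ) : ℕ → ℤ
  | 0 => 0
  | 1 => 1
  | n + 2 => cfA ω (n + 2) * cfP ω (n + 1) + cfP ω n

/-- The products `x₀ x₁ ⋯ xₙ` of the Gauss-map iterates. -/
noncomputable def cfBeta (ω : ℝ) (n : ℕ) : ℝ := ∏ i ∈ Finset.range (n + 1), cfX ω i

lemma cfBeta_pos (hirr : Irrational ω) (hω0 : 0 < ω) (hω1 : ω < 1) (n : ℕ) : 0 < cfBeta ω n :=
  Finset.prod_pos fun i _ => (cfX_mem_Ioo hirr hω0 hω1 i).1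

lemma cfBeta_succ (ω : ℝ) (n : ℕ) : cfBeta ω (n + 1) = cfBeta ω n * cfX ω (n + 1) :=
  Finset.prod_range_succ _ _

lemma cfBeta_add_two (hirr : Irrational ω) (hω0 : 0 < ω) (hω1 : ω < 1) (n : ℕ) :
    cfBeta ω (n + 2) = cfBeta ω n - cfA ω (n + 2) * cfBeta ω (n + 1) := by
  have h := cfA_add_cfX hirr hω0 hω1 (n + 1)
  have hx := (cfX_mem_Ioo hirr hω0 hω1 (n + 1)).1
  have h2 : cfX ω (n + 1 + 1) * cfX ω (n + 1) = 1 - cfA ω (n + 2) * cfX ω (n + 1) := by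
    have := mul_inv_cancel₀ hx.ne'
    rw [← h] at this
    linear_combination this
  rw [cfBeta_succ, cfBeta_succ]
  linear_combination cfBeta ω n * h2

lemma cfBeta_one (hirr : Irrational ω) (hω0 : 0 < ω) (hω1 : ω < 1) :
    cfBeta ω 1 = 1 - cfA ω 1 * ω := by
  have h := cfA_add_cfX hirr hω0 hω1 0
  have h2 := mul_inv_cancel₀ hω0.ne'
  change _ = ω⁻¹ at h
  rw [← h] at h2
  simp only [cfBeta, Finset.prod_range_succ, Finset.prod_range_zero]
  change 1 * ω * cfX ω 1 = _
  simp only [zero_add] at h2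
  linear_combination h2

lemma cfQ_mul_sub_cfP (hirr : Irrational ω) (hω0 : 0 < ω) (hω1 : ω < 1) (n : ℕ) :
    (cfQ ω n : ℝ) * ω - cfP ω n = (-1) ^ n * cfBeta ω n := by
  induction n using Nat.strong_induction_on with
  | _ n ih =>
    match n with
    | 0 => simp [cfQ, cfP, cfBeta, cfX]
    | 1 =>
      rw [cfBeta_one hirr hω0 hω1]
      simp [cfQ, cfP]
    | k + 2 =>
      have h0 := ih k (by omega)
      have h1 := ih (k + 1) (by omega)
      rw [cfBeta_add_two hirr hω0 hω1]
      simp only [cfQ, cfP]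
      push_cast
      linear_combination h0 + (cfA ω (k + 2) : ℝ) * h1

lemma cfQ_mul_cfBeta_add (hirr : Irrational ω) (hω0 : 0 < ω) (hω1 : ω < 1) (n : ℕ) :
    (cfQ ω (n + 1) : ℝ) * cfBeta ω n + cfQ ω n * cfBeta ω (n + 1) = 1 := by
  induction n with
  | zero =>
    rw [zero_add, cfBeta_one hirr hω0 hω1]
    simp [cfQ, cfBeta, cfX]
  | succ n ih =>
    rw [cfBeta_add_two hirr hω0 hω1]
    simp only [cfQ]
    push_cast
    linear_combination ih

lemma cfQ_succ_le_of_isDiophantine (hirr : Irrational ω) (hω0 : 0 < ω) (hω1 : ω < 1)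
    {C τ : ℝ} (hC : 0 < C) (hdio : IsDiophantine C τ ω) (n : ℕ) :
    (cfQ ω (n + 1) : ℝ) ≤ C⁻¹ * (cfQ ω n : ℝ) ^ τ := by
  have hq : (0 : ℝ) < cfQ ω n := by exact_mod_cast one_le_cfQ hirr hω0 hω1 n
  have hq0 : (cfQ ω n : ℤ) ≠ 0 := by exact_mod_cast hq.ne'
  have hd := hdio (cfP ω n) (cfQ ω n) hq0
  have hb := cfBeta_pos hirr hω0 hω1 n
  simp only [Int.cast_natCast, abs_of_pos hq] at hd
  rw [cfQ_mul_sub_cfP hirr hω0 hω1, abs_mul, abs_pow, abs_neg, abs_one, one_pow, one_mul,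
    abs_of_pos hb, div_le_iff₀ (by positivity)] at hd
  have h1 : (cfQ ω (n + 1) : ℝ) * cfBeta ω n ≤ 1 := by
    have := cfQ_mul_cfBeta_add hirr hω0 hω1 n
    have := mul_nonneg hq.le (cfBeta_pos hirr hω0 hω1 (n + 1)).le
    linarith
  rw [inv_mul_eq_div, le_div_iff₀ hC]
  calc (cfQ ω (n + 1) : ℝ) * C ≤ cfQ ω (n + 1) * (cfBeta ω n * (cfQ ω n : ℝ) ^ τ) := by gcongr
    _ = (cfQ ω (n + 1) * cfBeta ω n) * (cfQ ω n : ℝ) ^ τ := by ring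
    _ ≤ _ := mul_le_of_le_one_left (by positivity) h1

lemma goldenRatio_pow_le_cfQ (hirr : Irrational ω) (hω0 : 0 < ω) (hω1 : ω < 1) (k : ℕ) :
    goldenRatio ^ k ≤ (cfQ ω (k + 1) : ℝ) := by
  have hadd : ∀ n, (cfQ ω (n + 1) : ℝ) + cfQ ω n ≤ cfQ ω (n + 2) := fun n => by
    exact_mod_cast cfQ_add_le hirr hω0 hω1 n
  have hone : ∀ n, (1 : ℝ) ≤ cfQ ω n := fun n => by exact_mod_cast one_le_cfQ hirr hω0 hω1 n
  induction k using Nat.strong_induction_on with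
  | _ k ih =>
    match k with
    | 0 => simpa using hone 1
    | 1 =>
      have := hadd 0
      have := hone 0
      have := hone 1
      rw [pow_one]
      linarith [goldenRatio_lt_two]
    | j + 2 =>
      have h0 := ih j (by omega)
      have h1 := ih (j + 1) (by omega)
      have h2 := hadd (j + 1)
      have h3 : goldenRatio ^ (j + 2) = goldenRatio ^ (j + 1) + goldenRatio ^ j := by
        rw [pow_succ, pow_succ]
        linear_combination goldenRatio ^ j * goldenRatio_sq
      rw [h3]
      exact (add_le_add h1 h0).trans h2

lemma brj2_term_le (hirr : Irrational ω) (hω0 : 0 < ω) (hω1 : ω < 1) {C τ : ℝ} (hC0 : 0 < C)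
    (hdio : IsDiophantine C τ ω) (Δ : ℝ) (n : ℕ) :
    exp (-(cfQ ω (n + 1) : ℝ) * Δ) * cfQ ω (n + 2) * log (cfA ω (n + 2)) ≤
      C⁻¹ * log C⁻¹ * (exp (-(cfQ ω (n + 1) : ℝ) * Δ) * (cfQ ω (n + 1) : ℝ) ^ τ) +
      C⁻¹ * (τ - 1) * (exp (-(cfQ ω (n + 1) : ℝ) * Δ) * (cfQ ω (n + 1) : ℝ) ^ τ *
        log (cfQ ω (n + 1))) := by
  have hq : (0 : ℝ) < cfQ ω (n + 1) := by exact_mod_cast one_le_cfQ hirr hω0 hω1 (n + 1)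
  have ha : (1 : ℝ) ≤ cfA ω (n + 2) := by exact_mod_cast one_le_cfA hirr hω0 hω1 (n + 1)
  have hqq := cfQ_succ_le_of_isDiophantine hirr hω0 hω1 hC0 hdio (n + 1)
  have haq : (cfA ω (n + 2) : ℝ) * cfQ ω (n + 1) ≤ cfQ ω (n + 2) := by
    exact_mod_cast Nat.le_add_right (cfA ω (n + 2) * cfQ ω (n + 1)) (cfQ ω n)
  have hlog : log (cfA ω (n + 2)) ≤ log C⁻¹ + (τ - 1) * log (cfQ ω (n + 1)) := by
    have h := log_le_log (by positivity) (haq.trans hqq)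
    rw [log_mul (by positivity) hq.ne', log_mul (by positivity) (by positivity),
      log_rpow hq] at h
    linarith
  calc exp (-(cfQ ω (n + 1) : ℝ) * Δ) * cfQ ω (n + 2) * log (cfA ω (n + 2))
      ≤ exp (-(cfQ ω (n + 1) : ℝ) * Δ) * (C⁻¹ * (cfQ ω (n + 1) : ℝ) ^ τ) *
        (log C⁻¹ + (τ - 1) * log (cfQ ω (n + 1))) := by
        have := log_nonneg ha
        gcongr
    _ = _ := by ring

end Denominators

lemma lintegral_Ioi_comp_mul_left {g : ℝ → ℝ} {a Δ : ℝ} (hΔ : 0 < Δ)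
    (hg : IntegrableOn g (Ioi a)) (hg0 : ∀ y ∈ Ioi a, 0 ≤ g y) :
    ∫⁻ x in Ioi (a / Δ), ENNReal.ofReal (Δ * g (Δ * x)) = ENNReal.ofReal (∫ y in Ioi a, g y) := by
  have ha : Δ * (a / Δ) = a := mul_div_cancel₀ a hΔ.ne'
  have hi : IntegrableOn (fun x => Δ * g (Δ * x)) (Ioi (a / Δ)) := by
    refine Integrable.const_mul ?_ Δ
    exact (integrableOn_Ioi_comp_mul_left_iff g (a / Δ) hΔ).mpr (by rwa [ha])
  rw [← ofReal_integral_eq_lintegral_ofReal hi, integral_const_mul,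
    integral_comp_mul_left_Ioi g _ hΔ, ha, smul_eq_mul, mul_inv_cancel_left₀ hΔ.ne']
  filter_upwards [ae_restrict_mem measurableSet_Ioi] with x hx
  refine mul_nonneg hΔ.le (hg0 _ ?_)
  rw [mem_Ioi, mul_comm]
  exact (div_lt_iff₀ hΔ).mp hx

lemma exp_neg_mul_rpow_div_eq {τ Δ x : ℝ} (hΔ : 0 < Δ) (hx : 0 < x) :
    exp (-x * Δ) * x ^ τ / x =
      Δ * (Δ ^ (-τ) * (exp (-(Δ * x)) * (Δ * x) ^ (τ - 1))) := by
  rw [mul_rpow hΔ.le hx.le, rpow_neg hΔ.le, rpow_sub_one hΔ.ne', rpow_sub_one hx.ne',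
    show -(Δ * x) = -x * Δ by ring]
  have := (rpow_pos_of_pos hΔ τ).ne'
  field_simp

lemma lintegral_exp_neg_mul_rpow_le {τ Δ : ℝ} (hτ : 0 < τ) (hΔ : 0 < Δ) :
    ∫⁻ x in Ioi (τ / Δ), ENNReal.ofReal (exp (-x * Δ) * x ^ τ / x) ≤
      ENNReal.ofReal (Δ ^ (-τ) * (Gamma τ / 2)) := by
  have hint : IntegrableOn (fun y : ℝ => exp (-y) * y ^ (τ - 1)) (Ioi τ) :=
    (GammaIntegral_convergent hτ).mono_set (Ioi_subset_Ioi hτ.le)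
  have hcongr : ∀ x ∈ Ioi (τ / Δ), ENNReal.ofReal (exp (-x * Δ) * x ^ τ / x) =
      ENNReal.ofReal (Δ * (Δ ^ (-τ) * (exp (-(Δ * x)) * (Δ * x) ^ (τ - 1)))) := fun x hx => by
    rw [exp_neg_mul_rpow_div_eq hΔ ((div_pos hτ hΔ).trans hx)]
  rw [setLIntegral_congr_fun measurableSet_Ioi hcongr,
    lintegral_Ioi_comp_mul_left (g := fun y => Δ ^ (-τ) * (exp (-y) * y ^ (τ - 1))) hΔ
      (hint.const_mul _) fun y hy => ?_, integral_const_mul]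
  · apply ENNReal.ofReal_le_ofReal
    gcongr
    exact integral_Ioi_self_le_half_Gamma hτ
  · have : 0 < y := hτ.trans hy
    positivity

lemma lintegral_exp_neg_mul_rpow_mul_log_le {τ Δ : ℝ} (hτ : 1 < τ) (hΔ : 0 < Δ) (hΔ1 : Δ ≤ 1) :
    ∫⁻ x in Ioi ((τ + 1) / Δ), ENNReal.ofReal (exp (-x * Δ) * x ^ τ * log x / x) ≤
      ENNReal.ofReal (Δ ^ (-τ) * (log Δ⁻¹ * (Gamma τ / 2) + LambdaInt τ)) := by
  have hτ0 : 0 < τ := by linarith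
  have hℓ : 0 ≤ log Δ⁻¹ := log_nonneg ((one_le_inv₀ hΔ).mpr hΔ1)
  have hG := GammaIntegral_convergent hτ0
  have hL := integrableOn_exp_neg_mul_rpow_mul_abs_log hτ
  have hsub : Ioi (τ + 1) ⊆ Ioi (0 : ℝ) := Ioi_subset_Ioi (by linarith)
  have hG1 := (hG.mono_set hsub).const_mul (log Δ⁻¹)
  have hL1 := hL.mono_set hsub
  have hcongr : ∀ x ∈ Ioi ((τ + 1) / Δ), ENNReal.ofReal (exp (-x * Δ) * x ^ τ * log x / x) =
      ENNReal.ofReal (Δ * (Δ ^ (-τ) * (log Δ⁻¹ * (exp (-(Δ * x)) * (Δ * x) ^ (τ - 1)) +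
        exp (-(Δ * x)) * (Δ * x) ^ (τ - 1) * |log (Δ * x)|))) := fun x hx => by
    have hx0 : 0 < x := (div_pos (by linarith) hΔ).trans hx
    have hx1 : 1 ≤ Δ * x := by
      have := (div_lt_iff₀ hΔ).mp hx
      linarith
    have hl : log x = log Δ⁻¹ + |log (Δ * x)| := by
      rw [abs_of_nonneg (log_nonneg hx1), log_mul hΔ.ne' hx0.ne', log_inv]
      ring
    rw [mul_div_right_comm, exp_neg_mul_rpow_div_eq hΔ hx0, hl]
    congr 1
    ring
  rw [setLIntegral_congr_fun measurableSet_Ioi hcongr,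
    lintegral_Ioi_comp_mul_left (g := fun y => Δ ^ (-τ) * (log Δ⁻¹ * (exp (-y) * y ^ (τ - 1)) +
      exp (-y) * y ^ (τ - 1) * |log y|)) hΔ ((hG1.add hL1).const_mul _) fun y hy => ?_,
    integral_const_mul, integral_add hG1 hL1, integral_const_mul]
  · apply ENNReal.ofReal_le_ofReal
    gcongr
    · refine le_trans ?_ (integral_Ioi_self_le_half_Gamma hτ0)
      refine setIntegral_mono_set (hG.mono_set (Ioi_subset_Ioi hτ0.le)) ?_
        (Ioi_subset_Ioi (by linarith)).eventuallyLE
      filter_upwards [ae_restrict_mem measurableSet_Ioi] with y hy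
      have : 0 < y := hτ0.trans hy
      positivity
    · refine setIntegral_mono_set hL ?_ hsub.eventuallyLE
      filter_upwards [ae_restrict_mem measurableSet_Ioi] with y hy
      have : 0 < y := hy
      positivity
  · have : 0 < y := hsub hy
    positivity

lemma rpow_mul_exp_neg_mul_log_antitoneOn {s Δ : ℝ} (hs : 0 < s) (hΔ : 0 < Δ)
    (he : exp 1 ≤ (s + 1) / Δ) :
    AntitoneOn (fun x : ℝ => exp (-x * Δ) * x ^ s * log x) (Ici ((s + 1) / Δ)) := by
  have h1 := rpow_mul_exp_neg_antitoneOn (show 0 < s + 1 by linarith) hΔ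
  intro x hx y hy hxy
  have hxe : exp 1 ≤ x := he.trans hx
  have hye : exp 1 ≤ y := hxe.trans hxy
  have hx0 : 0 < x := (exp_pos 1).trans_le hxe
  have hy0 : 0 < y := hx0.trans_le hxy
  have h2 := log_div_self_antitoneOn (a := x) (b := y) hxe hye hxy
  have h3 : 0 ≤ log y / y := div_nonneg (log_nonneg ((one_le_exp zero_le_one).trans hye)) hy0.le
  have heq : ∀ z : ℝ, 0 < z →
      exp (-z * Δ) * z ^ s * log z = exp (-z * Δ) * z ^ (s + 1) * (log z / z) := fun z hz => by
    rw [rpow_add_one hz.ne']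
    field_simp
  dsimp only
  rw [heq x hx0, heq y hy0]
  exact mul_le_mul (h1 hx hy hxy) h2 h3 (by positivity)

/-- bound on `𝔅rj₂(Δ)` for a `(C,τ)`-Diophantine irrational `ω ∈ (0,1)` with
`0 < C ≤ 1`, `τ > 1` and `Δ ∈ (0, min(τ⁻¹, τ e⁻¹)]`. -/
theorem brj2_bound_of_diophantine (ω : ℝ) (hirr : Irrational ω) (hω0 : 0 < ω) (hω1 : ω < 1)
    (C τ : ℝ) (hC0 : 0 < C) (hC1 : C ≤ 1) (hτ : 1 < τ) (hdio : IsDiophantine C τ ω)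
    (Δ : ℝ) (hΔ0 : 0 < Δ) (hΔ : Δ ≤ min τ⁻¹ (τ * Real.exp (-1))) :
    Brj2 ω Δ ≤ ENNReal.ofReal
      (C⁻¹ * (τ - 1) * (τ * Real.exp (-1)) ^ τ / Real.log goldenφ * Δ ^ (-τ) *
        ((Real.log Δ⁻¹) ^ 2
          + (Real.log C⁻¹ / (τ - 1) + Real.Gamma τ / (2 * (τ * Real.exp (-1)) ^ τ)
              + Real.log (3 * goldenφ * (τ + 1) ^ 2)) * Real.log Δ⁻¹
          + (Real.log C⁻¹ / (τ - 1) *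
              (Real.log (3 * τ * goldenφ) + Real.Gamma τ / (2 * (τ * Real.exp (-1)) ^ τ))
            + Real.log (3 * goldenφ * (τ + 1)) * Real.log (τ + 1)
            + LambdaInt τ / (τ * Real.exp (-1)) ^ τ))) := by
  have hτ0 : 0 < τ := by linarith
  have hΔτ : Δ ≤ τ⁻¹ := hΔ.trans (min_le_left _ _)
  have hΔe : Δ ≤ τ * exp (-1) := hΔ.trans (min_le_right _ _)
  have hΔ1 : Δ ≤ 1 := hΔτ.trans (inv_le_one_of_one_le₀ hτ.le)
  have hφ : goldenφ = goldenRatio := rfl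
  have hφ0 := goldenRatio_pos
  have hlogφ : 0 < log goldenRatio := log_pos one_lt_goldenRatio
  have hLC : 0 ≤ log C⁻¹ := log_nonneg ((one_le_inv₀ hC0).mpr hC1)
  have hℓ : 0 ≤ log Δ⁻¹ := log_nonneg ((one_le_inv₀ hΔ0).mpr hΔ1)
  have hΓ := Gamma_pos_of_pos hτ0
  have hΛ : 0 ≤ LambdaInt τ := setIntegral_nonneg measurableSet_Ioi fun y hy => by
    have : 0 < y := hy
    positivity
  have hXe : exp 1 ≤ τ / Δ := by
    rw [le_div_iff₀ hΔ0]
    calc exp 1 * Δ ≤ exp 1 * (τ * exp (-1)) := by gcongr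
      _ = τ * (exp 1 * exp (-1)) := by ring
      _ = τ := by rw [← exp_add]; simp
  have hYe : exp 1 ≤ (τ + 1) / Δ := hXe.trans (by gcongr; linarith)
  have h1e : (1 : ℝ) ≤ exp 1 := one_le_exp zero_le_one
  set T : ℝ := (τ * exp (-1)) ^ τ with hT
  have hT0 : 0 < T := by positivity
  set D : ℝ := Δ ^ (-τ) with hD
  have hD0 : 0 < D := by positivity
  set Q : ℕ → ℝ := fun k => cfQ ω (k + 1) with hQ
  have hQ1 : ∀ k, 1 ≤ Q k := fun k => by
    simp only [hQ]
    exact_mod_cast one_le_cfQ hirr hω0 hω1 (k + 1)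
  have hQpow : ∀ k, goldenRatio ^ k ≤ Q k := goldenRatio_pow_le_cfQ hirr hω0 hω1
  have hadd : ∀ k, Q (k + 1) + Q k ≤ Q (k + 2) := fun k => by
    simp only [hQ]
    exact_mod_cast cfQ_add_le hirr hω0 hω1 (k + 1)
  have hmono : Monotone Q := monotone_nat_of_le_succ fun k => by
    simp only [hQ]
    exact_mod_cast (Nat.le_add_right _ _).trans (cfQ_add_le hirr hω0 hω1 k)
  have hmax : ∀ x, 1 ≤ x → exp (-x * Δ) * x ^ τ ≤ T * D := fun x hx =>
    rpow_mul_exp_neg_le hτ0 hΔ0 (by linarith)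
  have hS1 := sum_ofReal_le_of_antitoneOn hQ1 hQpow hmono hadd (h1e.trans hXe)
    (fun x hx _ => hmax x hx) (by positivity) (rpow_mul_exp_neg_antitoneOn hτ0 hΔ0)
    (fun x hx => by
      have : 0 < x := (exp_pos 1).trans_le (hXe.trans hx)
      positivity)
    (by positivity) (lintegral_exp_neg_mul_rpow_le hτ0 hΔ0)
  have hS2 := sum_ofReal_le_of_antitoneOn hQ1 hQpow hmono hadd (h1e.trans hYe)
    (F := fun x => exp (-x * Δ) * x ^ τ * log x) (M := T * D * log ((τ + 1) / Δ))
    (fun x hx hxY => mul_le_mul (hmax x hx) (log_le_log (by linarith) hxY) (log_nonneg hx)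
      (by positivity))
    (mul_nonneg (by positivity) (log_nonneg (h1e.trans hYe)))
    (rpow_mul_exp_neg_mul_log_antitoneOn hτ0 hΔ0 hYe)
    (fun x hx => by
      have hx1 : 1 ≤ x := h1e.trans (hYe.trans hx)
      have := log_nonneg hx1
      positivity)
    (by positivity) (lintegral_exp_neg_mul_rpow_mul_log_le hτ hΔ0 hΔ1)
  have hY1 := log_nonneg (h1e.trans hYe)
  have hY2 : 0 ≤ log (3 * goldenRatio * ((τ + 1) / Δ)) :=
    log_nonneg (by nlinarith [one_lt_goldenRatio])
  have hX2 : 0 ≤ log (3 * goldenRatio * (τ / Δ)) :=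
    log_nonneg (by nlinarith [one_lt_goldenRatio])
  have hc : 0 ≤ C⁻¹ * (τ - 1) := mul_nonneg (by positivity) (by linarith)
  calc Brj2 ω Δ
      ≤ ∑' k, (ENNReal.ofReal (C⁻¹ * log C⁻¹) * ENNReal.ofReal (exp (-Q k * Δ) * Q k ^ τ) +
        ENNReal.ofReal (C⁻¹ * (τ - 1)) *
          ENNReal.ofReal (exp (-Q k * Δ) * Q k ^ τ * log (Q k))) := by
        refine ENNReal.tsum_le_tsum fun n => ?_
        have hq := hQ1 n
        have hl := log_nonneg hq
        rw [← ENNReal.ofReal_mul (by positivity), ← ENNReal.ofReal_mul hc,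
          ← ENNReal.ofReal_add (by positivity) (mul_nonneg hc (by positivity))]
        exact ENNReal.ofReal_le_ofReal (brj2_term_le hirr hω0 hω1 hC0 hdio Δ n)
    _ ≤ _ := by
        rw [ENNReal.tsum_add, ENNReal.tsum_mul_left, ENNReal.tsum_mul_left]
        refine (add_le_add (mul_le_mul_right hS1 _) (mul_le_mul_right hS2 _)).trans_eq ?_
        rw [← ENNReal.ofReal_mul (by positivity), ← ENNReal.ofReal_mul hc,
          ← ENNReal.ofReal_add (by positivity) (mul_nonneg hc (by positivity)), hφ]
        congr 1
        have e1 : log (3 * goldenRatio * (τ / Δ)) =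
            log (3 * τ * goldenRatio) + log Δ⁻¹ := by
          rw [← log_mul (by positivity) (by positivity)]
          congr 1
          ring
        have e2 : log (3 * goldenRatio * ((τ + 1) / Δ)) =
            log (3 * goldenRatio * (τ + 1)) + log Δ⁻¹ := by
          rw [← log_mul (by positivity) (by positivity)]
          congr 1
          ring
        have e3 : log ((τ + 1) / Δ) = log (τ + 1) + log Δ⁻¹ := by
          rw [← log_mul (by positivity) (by positivity)]
          congr 1
        have e4 : log (3 * goldenRatio * (τ + 1) ^ 2) =
            log (3 * goldenRatio * (τ + 1)) + log (τ + 1) := by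
          rw [← log_mul (by positivity) (by positivity)]
          congr 1
          ring
        rw [e1, e2, e3, e4]
        have hτ1 : τ - 1 ≠ 0 := by linarith
        field_simp
        ring
end

section
/- Let ω ∈ (0,1) be irrational, let 0 < β < β' be reals, set γ = β'/β, let N ≥ 1 be an integer, and assume that e^{βn} ≤ M_n and M'_n ≤ e^{β'n} for all n ≥ N. Then for every Δ > 0: 𝔅rj₁(Δ) ≤ D₁(N,Δ) + e^{β'} ( Γ_Eul(γ)/β + (γ e^{−1})^γ ) · Δ^{−γ}, where D₁(N,Δ) = Σ_{n=1}^{N−1} e^{−q_n Δ} q_{n+1} − Σ_{n=1}^{N−1} e^{−e^{βn} Δ} e^{β'(n+1)}. -/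
open Real
open scoped ENNReal

noncomputable section

/-- `M_n = a_1 a_2 ⋯ a_n`. -/
def cfM (ω : ℝ) : ℕ → ℕ
  | 0 => 1
  | n + 1 => cfM ω n * cfA ω (n + 1)

/-- `M'_n = (1+a_1)(1+a_2)⋯(1+a_n)`. -/
def cfM' (ω : ℝ) : ℕ → ℕ
  | 0 => 1
  | n + 1 => cfM' ω n * (1 + cfA ω (n + 1))

/-- First Brjuno-like function `𝔅rj₁(Δ) = Σ_{n=1}^∞ e^{-q_n Δ} q_{n+1}`, valued in `[0,∞]`. -/
def Brj1 (ω Δ : ℝ) : ℝ≥0∞ :=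
  ∑' n : ℕ, ENNReal.ofReal (Real.exp (-(cfQ ω (n + 1) : ℝ) * Δ) * (cfQ ω (n + 2) : ℝ))

end

section

open MeasureTheory Set intervalIntegral

theorem cfM_le_cfQ (ω : ℝ) (n : ℕ) : cfM ω n ≤ cfQ ω n := by
  induction n with
  | zero => simp [cfM, cfQ]
  | succ n ih =>
    cases n with
    | zero => simp [cfM, cfQ]
    | succ n =>
      rw [cfM, cfQ, mul_comm]
      exact (Nat.mul_le_mul_left _ ih).trans (Nat.le_add_right _ _)

theorem cfM'_le_succ (ω : ℝ) (n : ℕ) : cfM' ω n ≤ cfM' ω (n + 1) :=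
  Nat.le_mul_of_pos_right _ (by omega)

theorem cfQ_le_cfM' (ω : ℝ) (n : ℕ) : cfQ ω n ≤ cfM' ω n := by
  induction n using Nat.twoStepInduction with
  | zero => simp [cfM', cfQ]
  | one => simp [cfM', cfQ]
  | more n ih ih' =>
    rw [cfM', cfQ]
    have := ih.trans (cfM'_le_succ ω n)
    nlinarith [Nat.mul_le_mul_left (cfA ω (n + 2)) ih']

/-- The sum of a unimodal function over unit-spaced points is at most its integral plus
its maximum; the correction term `f (min _ c)` keeps track of the rising part. -/
theorem sum_range_le_integral_add_of_unimodal {f : ℝ → ℝ} {c : ℝ} (hf : Continuous f)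
    (hmono : MonotoneOn f (Iic c)) (hanti : AntitoneOn f (Ici c)) (a : ℝ) (K : ℕ) :
    ∑ i ∈ Finset.range (K + 1), f (a + i) ≤ (∫ t in a..a + K, f t) + f (min (a + K) c) := by
  have hle_max (x : ℝ) : f x ≤ f c := by
    rcases le_total x c with h | h
    · exact hmono h self_mem_Iic h
    · exact hanti self_mem_Ici h h
  have integral_lower (x m : ℝ) (h : ∀ t ∈ Icc x (x + 1), m ≤ f t) :
      m ≤ ∫ t in x..x + 1, f t := by
    have := integral_mono_on (μ := volume) (by linarith : x ≤ x + 1)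
      intervalIntegrable_const (hf.intervalIntegrable _ _) h
    simpa using this
  induction K with
  | zero =>
    rcases le_total a c with h | h
    · simp [h]
    · simpa [h] using hle_max a
  | succ K ih =>
    rw [Finset.sum_range_succ]
    set x : ℝ := a + K with hx
    have hx1 : a + ((K + 1 : ℕ) : ℝ) = x + 1 := by push_cast; ring
    rw [hx1, ← integral_add_adjacent_intervals (hf.intervalIntegrable a x)
      (hf.intervalIntegrable x (x + 1))]
    suffices f (min x c) + f (x + 1) ≤ (∫ t in x..x + 1, f t) + f (min (x + 1) c) by linarith
    rcases le_total (x + 1) c with h | h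
    · have hxc : x ≤ c := by linarith
      rw [min_eq_left h, min_eq_left hxc]
      have := integral_lower x (f x) fun t ht =>
        hmono hxc (show t ≤ c from ht.2.trans h) ht.1
      linarith
    · rw [min_eq_right h]
      rcases le_total c x with hxc | hxc
      · rw [min_eq_right hxc]
        have := integral_lower x (f (x + 1)) fun t ht =>
          hanti (show c ≤ t from hxc.trans ht.1) h ht.2
        linarith
      · rw [min_eq_left hxc]
        have := integral_lower x (min (f x) (f (x + 1))) fun t ht => by
          rcases le_total t c with htc | htc
          · exact (min_le_left _ _).trans (hmono hxc htc ht.1)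
          · exact (min_le_right _ _).trans (hanti htc h ht.2)
        rcases min_cases (f x) (f (x + 1)) with ⟨e, -⟩ | ⟨e, -⟩ <;> rw [e] at this
        · linarith [hle_max (x + 1)]
        · linarith [hle_max x]

/-- The function `t ↦ exp (-e^{βt} Δ) e^{β't}`, whose integral over `ℝ` is a Gamma integral. -/
noncomputable def gompertz (β β' Δ t : ℝ) : ℝ := Real.exp (-Real.exp (β * t) * Δ) * Real.exp (β' * t)

theorem continuous_gompertz (β β' Δ : ℝ) : Continuous (gompertz β β' Δ) := by
  unfold gompertz; fun_prop

theorem gompertz_pos (β β' Δ t : ℝ) : 0 < gompertz β β' Δ t := by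
  unfold gompertz; positivity

variable {β β' Δ : ℝ}

theorem image_exp_mul_univ (hβ : 0 < β) (hΔ : 0 < Δ) :
    (fun t : ℝ => Real.exp (β * t) * Δ) '' univ = Ioi 0 := by
  ext y
  simp only [image_univ, mem_range, mem_Ioi]
  refine ⟨?_, fun hy => ⟨Real.log (y / Δ) / β, ?_⟩⟩
  · rintro ⟨t, rfl⟩; positivity
  · rw [mul_div_cancel₀ _ hβ.ne', Real.exp_log (by positivity), div_mul_cancel₀ _ hΔ.ne']

theorem injective_exp_mul (hβ : 0 < β) (hΔ : 0 < Δ) :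
    Function.Injective fun t : ℝ => Real.exp (β * t) * Δ := fun x y h => by
  simpa [hΔ.ne', hβ.ne'] using h

theorem hasDerivAt_exp_mul (β Δ t : ℝ) :
    HasDerivAt (fun t : ℝ => Real.exp (β * t) * Δ) (Real.exp (β * t) * β * Δ) t := by
  simpa using (((hasDerivAt_id t).const_mul β).exp).mul_const Δ

theorem abs_deriv_smul_Gamma_integrand (hβ : 0 < β) (hΔ : 0 < Δ) (t : ℝ) :
    |Real.exp (β * t) * β * Δ| • (Real.exp (-(Real.exp (β * t) * Δ)) *
      (Real.exp (β * t) * Δ) ^ (β' / β - 1)) =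
      β * Δ ^ (β' / β) * gompertz β β' Δ t := by
  have h : Real.exp (β * t) ^ (β' / β) = Real.exp (β' * t) := by
    rw [← Real.exp_mul]; congr 1; field_simp
  rw [abs_of_pos (by positivity), smul_eq_mul, Real.rpow_sub_one (by positivity),
    Real.mul_rpow (by positivity) hΔ.le, h, gompertz, neg_mul]
  field_simp

theorem integrable_gompertz (hβ : 0 < β) (hβ' : 0 < β') (hΔ : 0 < Δ) :
    Integrable (gompertz β β' Δ) := by
  have h := Real.GammaIntegral_convergent (div_pos hβ' hβ)
  rw [← image_exp_mul_univ hβ hΔ, integrableOn_image_iff_integrableOn_abs_deriv_smul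
    MeasurableSet.univ (fun t _ => (hasDerivAt_exp_mul β Δ t).hasDerivWithinAt)
    (injective_exp_mul hβ hΔ).injOn, integrableOn_univ] at h
  simp only [abs_deriv_smul_Gamma_integrand hβ hΔ] at h
  have hne : β * Δ ^ (β' / β) ≠ 0 := by positivity
  exact (integrable_const_mul_iff hne.isUnit _).1 h

theorem integral_gompertz (hβ : 0 < β) (hβ' : 0 < β') (hΔ : 0 < Δ) :
    ∫ t, gompertz β β' Δ t = Real.Gamma (β' / β) / β * Δ ^ (-(β' / β)) := by
  rw [Real.Gamma_eq_integral (div_pos hβ' hβ), ← image_exp_mul_univ hβ hΔ,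
    integral_image_eq_integral_abs_deriv_smul MeasurableSet.univ
      (fun t _ => (hasDerivAt_exp_mul β Δ t).hasDerivWithinAt)
      (injective_exp_mul hβ hΔ).injOn, setIntegral_univ]
  simp only [abs_deriv_smul_Gamma_integrand hβ hΔ]
  rw [MeasureTheory.integral_const_mul, Real.rpow_neg hΔ.le]
  field_simp

theorem hasDerivAt_gompertz (β β' Δ t : ℝ) :
    HasDerivAt (gompertz β β' Δ)
      (gompertz β β' Δ t * (β' - Real.exp (β * t) * β * Δ)) t := by
  have h1 := (hasDerivAt_exp_mul β Δ t).fun_neg.exp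
  have h2 := ((hasDerivAt_id t).const_mul β').exp
  refine ((h1.fun_mul h2).congr_deriv ?_).congr_of_eventuallyEq ?_
  · simp only [gompertz, id, neg_mul]; ring
  · exact .of_forall fun s => by simp [gompertz]

theorem monotoneOn_gompertz (hβ : 0 < β) (hβ' : 0 < β') (hΔ : 0 < Δ) :
    MonotoneOn (gompertz β β' Δ) (Iic (Real.log (β' / β / Δ) / β)) := by
  refine monotoneOn_of_deriv_nonneg (convex_Iic _) (continuous_gompertz ..).continuousOn
    (fun t _ => (hasDerivAt_gompertz β β' Δ t).differentiableAt.differentiableWithinAt)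
    fun t ht => ?_
  rw [interior_Iic, mem_Iio, lt_div_iff₀ hβ, Real.lt_log_iff_exp_lt (by positivity),
    lt_div_iff₀ hΔ, lt_div_iff₀ hβ, mul_comm t β] at ht
  rw [(hasDerivAt_gompertz β β' Δ t).deriv]
  exact mul_nonneg (gompertz_pos ..).le (by nlinarith)

theorem antitoneOn_gompertz (hβ : 0 < β) (hβ' : 0 < β') (hΔ : 0 < Δ) :
    AntitoneOn (gompertz β β' Δ) (Ici (Real.log (β' / β / Δ) / β)) := by
  refine antitoneOn_of_deriv_nonpos (convex_Ici _) (continuous_gompertz ..).continuousOn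
    (fun t _ => (hasDerivAt_gompertz β β' Δ t).differentiableAt.differentiableWithinAt)
    fun t ht => ?_
  rw [interior_Ici, mem_Ioi, div_lt_iff₀ hβ, Real.log_lt_iff_lt_exp (by positivity),
    div_lt_iff₀ hΔ, div_lt_iff₀ hβ, mul_comm t β] at ht
  rw [(hasDerivAt_gompertz β β' Δ t).deriv]
  exact mul_nonpos_of_nonneg_of_nonpos (gompertz_pos ..).le (by nlinarith)

theorem gompertz_peak (hβ : 0 < β) (hβ' : 0 < β') (hΔ : 0 < Δ) :
    gompertz β β' Δ (Real.log (β' / β / Δ) / β) =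
      (β' / β * Real.exp (-1)) ^ (β' / β) * Δ ^ (-(β' / β)) := by
  have h : β' * (Real.log (β' / β / Δ) / β) = Real.log (β' / β / Δ) * (β' / β) := by ring
  rw [gompertz, mul_div_cancel₀ _ hβ.ne', Real.exp_log (by positivity), neg_mul,
    div_mul_cancel₀ _ hΔ.ne', h, ← Real.rpow_def_of_pos (by positivity),
    Real.div_rpow (by positivity) hΔ.le, Real.mul_rpow (by positivity) (by positivity),
    ← Real.exp_mul, neg_one_mul, Real.rpow_neg hΔ.le]
  ring

theorem sum_gompertz_le (hβ : 0 < β) (hβ' : 0 < β') (hΔ : 0 < Δ) (K : ℕ) :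
    ∑ i ∈ Finset.range K, gompertz β β' Δ (1 + i) ≤
      (Real.Gamma (β' / β) / β + (β' / β * Real.exp (-1)) ^ (β' / β)) * Δ ^ (-(β' / β)) := by
  have hmono := monotoneOn_gompertz hβ hβ' hΔ
  have hsum := sum_range_le_integral_add_of_unimodal (continuous_gompertz β β' Δ) hmono
    (antitoneOn_gompertz hβ hβ' hΔ) 1 K
  have hpeak := hmono (min_le_right (1 + (K : ℝ)) _) self_mem_Iic (min_le_right _ _)
  have hint : ∫ t in (1 : ℝ)..1 + K, gompertz β β' Δ t ≤ ∫ t, gompertz β β' Δ t := by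
    rw [integral_of_le (by simp)]
    exact setIntegral_le_integral (integrable_gompertz hβ hβ' hΔ)
      (.of_forall fun t => (gompertz_pos ..).le)
  rw [Finset.sum_range_succ] at hsum
  rw [gompertz_peak hβ hβ' hΔ] at hpeak
  rw [integral_gompertz hβ hβ' hΔ] at hint
  linarith [gompertz_pos β β' Δ (1 + K)]

end

/-- Khintchine–Lévy-type bound on `𝔅rj₁`. If `e^{βn} ≤ M_n` and `M'_n ≤ e^{β'n}`
for all `n ≥ N`, with `0 < β < β'` and `γ = β'/β`, then for every `Δ > 0`:
`𝔅rj₁(Δ) ≤ D₁(N,Δ) + e^{β'} (Γ(γ)/β + (γe⁻¹)^γ) Δ^{-γ}`. -/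
theorem brj1_bound_KL (ω : ℝ) (hirr : Irrational ω) (hω0 : 0 < ω) (hω1 : ω < 1)
    (β β' : ℝ) (hβ : 0 < β) (hββ' : β < β') (N : ℕ) (hN : 1 ≤ N)
    (hlo : ∀ n : ℕ, N ≤ n → Real.exp (β * n) ≤ (cfM ω n : ℝ))
    (hhi : ∀ n : ℕ, N ≤ n → (cfM' ω n : ℝ) ≤ Real.exp (β' * n))
    (Δ : ℝ) (hΔ : 0 < Δ) :
    Brj1 ω Δ ≤ ENNReal.ofReal
      ((∑ n ∈ Finset.Ico 1 N, Real.exp (-(cfQ ω n : ℝ) * Δ) * (cfQ ω (n + 1) : ℝ)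
          - ∑ n ∈ Finset.Ico 1 N, Real.exp (-Real.exp (β * n) * Δ) * Real.exp (β' * (n + 1)))
        + Real.exp β' * (Real.Gamma (β' / β) / β + (β' / β * Real.exp (-1)) ^ (β' / β)) *
            Δ ^ (-(β' / β))) := by
  have hβ' : 0 < β' := hβ.trans hββ'
  obtain ⟨M, rfl⟩ : ∃ M, N = M + 1 := ⟨N - 1, by omega⟩
  set T : ℕ → ℝ := fun n => Real.exp (-(cfQ ω n : ℝ) * Δ) * (cfQ ω (n + 1) : ℝ)
  have hT (n : ℕ) : 0 ≤ T n := by positivity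
  have hle (n : ℕ) (hn : M + 1 ≤ n) : T n ≤ Real.exp β' * gompertz β β' Δ n := by
    have h1 : Real.exp (β * n) ≤ cfQ ω n :=
      (hlo n hn).trans (mod_cast cfM_le_cfQ ω n)
    have h2 : (cfQ ω (n + 1) : ℝ) ≤ Real.exp β' * Real.exp (β' * n) := by
      refine (Nat.cast_le.2 (cfQ_le_cfM' ω (n + 1))).trans ((hhi (n + 1) (by omega)).trans_eq ?_)
      rw [← Real.exp_add]; push_cast; ring_nf
    calc T n ≤ Real.exp (-Real.exp (β * n) * Δ) * (Real.exp β' * Real.exp (β' * n)) := by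
          simp only [T]; gcongr
      _ = _ := by rw [gompertz]; ring
  have hG (n : ℕ) : Real.exp (-Real.exp (β * n) * Δ) * Real.exp (β' * (n + 1)) =
      Real.exp β' * gompertz β β' Δ n := by
    rw [gompertz, mul_add, mul_one, Real.exp_add]; ring
  refine ENNReal.tsum_le_of_sum_range_le fun K => ?_
  rw [← ENNReal.ofReal_sum_of_nonneg fun i _ => hT (i + 1)]
  refine ENNReal.ofReal_le_ofReal ?_
  simp only [hG, Finset.sum_Ico_eq_sum_range, Nat.add_sub_cancel]
  have hext : ∑ i ∈ Finset.range K, T (i + 1) ≤ ∑ i ∈ Finset.range (M + K), T (1 + i) := by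
    simp only [add_comm 1]
    exact Finset.sum_le_sum_of_subset_of_nonneg
      (Finset.range_subset_range.2 (by omega)) fun i _ _ => hT (i + 1)
  have hbound := mul_le_mul_of_nonneg_left (sum_gompertz_le hβ hβ' hΔ (M + K))
    (Real.exp_pos β').le
  have htail : ∑ i ∈ Finset.range K, T (1 + (M + i)) ≤
      ∑ i ∈ Finset.range K, Real.exp β' * gompertz β β' Δ (1 + (M + i : ℕ)) :=
    Finset.sum_le_sum fun i _ => (hle _ (by omega)).trans_eq (by push_cast; rfl)
  rw [Finset.sum_range_add] at hext
  rw [Finset.mul_sum, Finset.sum_range_add] at hbound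
  refine hext.trans ?_
  push_cast at hbound htail ⊢
  linarith
end

section
/- Let ω ∈ (0,1) be irrational and ε > 0. There exists δ₀ > 0 such that for all δ ∈ (0, δ₀): Σ_{(q,p) ∈ ℤ²∖{(0,0)}, |qω − p| > 1} e^{−(|p|+|q|)δ}/|qω − p| ≤ ( 4/(1+ω) + 2/(1−ω) + ε ) · δ^{−1} log(δ^{−1}). -/
open Real
open scoped ENNReal

/-- Points `(q, p)` of the lattice off the line `p = q ω` are determined by the sign of `q`, the
side of the line, `|q|`, and the integer part of `|q ω - p|` (shifted by one). -/
theorem injOn_lattice_code (ω : ℝ) :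
    Set.InjOn (fun qp : ℤ × ℤ ↦ (decide (0 ≤ qp.1), decide (0 < (qp.1 : ℝ) * ω - (qp.2 : ℝ)),
      qp.1.natAbs, ⌊|(qp.1 : ℝ) * ω - (qp.2 : ℝ)|⌋₊ - 1))
      {qp : ℤ × ℤ | 1 < |(qp.1 : ℝ) * ω - (qp.2 : ℝ)|} := by
  rintro ⟨q, p⟩ h ⟨q', p'⟩ h' heq
  simp only [Set.mem_ofPred_eq] at h h'
  simp only [Prod.mk.injEq, decide_eq_decide] at heq
  obtain ⟨hs, hb, hn, hk⟩ := heq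
  have hq : q = q' := by omega
  subst hq
  have h1 : 1 ≤ ⌊|(q : ℝ) * ω - (p : ℝ)|⌋₊ := Nat.le_floor (by exact_mod_cast h.le)
  have h2 : 1 ≤ ⌊|(q : ℝ) * ω - (p' : ℝ)|⌋₊ := Nat.le_floor (by exact_mod_cast h'.le)
  have hfl : ⌊|(q : ℝ) * ω - (p : ℝ)|⌋₊ = ⌊|(q : ℝ) * ω - (p' : ℝ)|⌋₊ := by omega
  have a1 := Nat.floor_le (abs_nonneg ((q : ℝ) * ω - (p : ℝ)))
  have a2 := Nat.lt_floor_add_one |(q : ℝ) * ω - (p : ℝ)|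
  have b1 := Nat.floor_le (abs_nonneg ((q : ℝ) * ω - (p' : ℝ)))
  have b2 := Nat.lt_floor_add_one |(q : ℝ) * ω - (p' : ℝ)|
  rw [hfl] at a1 a2
  have key : |(p : ℝ) - p'| < 1 := by
    by_cases hpos : 0 < (q : ℝ) * ω - (p : ℝ)
    · rw [abs_of_pos hpos] at a1 a2
      rw [abs_of_pos (hb.1 hpos)] at a1 a2 b1 b2
      rw [abs_lt]
      constructor <;> linarith
    · have hneg : ¬ 0 < (q : ℝ) * ω - (p' : ℝ) := fun h ↦ hpos (hb.2 h)
      rw [abs_of_nonpos (not_lt.1 hpos)] at a1 a2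
      rw [abs_of_nonpos (not_lt.1 hneg)] at a1 a2 b1 b2
      rw [abs_lt]
      constructor <;> linarith
  have hp : p = p' := by
    have : |p - p'| < 1 := by exact_mod_cast key
    rw [Int.abs_lt_one_iff] at this
    omega
  rw [hp]

/-- The decay rate in `|q|` along the two sides of the line `p = q ω`. -/
noncomputable def sideRate (ω : ℝ) (s b : Bool) : ℝ := if s = b then 1 - ω else 1 + ω

theorem natAbs_mul_sideRate_add_abs_le (ω : ℝ) (q p : ℤ) :
    (q.natAbs : ℝ) * sideRate ω (decide (0 ≤ q)) (decide (0 < (q : ℝ) * ω - (p : ℝ))) +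
      |(q : ℝ) * ω - (p : ℝ)| ≤ ((|p| + |q| : ℤ) : ℝ) := by
  have hn : (q.natAbs : ℝ) = |(q : ℝ)| := by rw [Nat.cast_natAbs, Int.cast_abs]
  have hp1 := le_abs_self (p : ℝ)
  have hp2 := neg_abs_le (p : ℝ)
  rw [hn]
  push_cast
  unfold sideRate
  by_cases hq : 0 ≤ q <;> by_cases ht : 0 < (q : ℝ) * ω - (p : ℝ)
  · have hq' : (0 : ℝ) ≤ q := by exact_mod_cast hq
    simp only [hq, ht, abs_of_nonneg hq', abs_of_pos ht, if_true]
    linarith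
  · have hq' : (0 : ℝ) ≤ q := by exact_mod_cast hq
    simp only [hq, ht, abs_of_nonneg hq', abs_of_nonpos (not_lt.1 ht), decide_true, decide_false,
      Bool.true_eq_false, if_false]
    linarith
  · have hq' : (q : ℝ) ≤ 0 := by exact_mod_cast (not_le.1 hq).le
    simp only [hq, ht, abs_of_nonpos hq', abs_of_pos ht, decide_true, decide_false,
      Bool.false_eq_true, if_false]
    linarith
  · have hq' : (q : ℝ) ≤ 0 := by exact_mod_cast (not_le.1 hq).le
    simp only [hq, ht, abs_of_nonpos hq', abs_of_nonpos (not_lt.1 ht), if_true]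
    linarith

theorem div_one_add_le_one_sub_exp_neg {x : ℝ} (hx : 0 < x) : x / (1 + x) ≤ 1 - exp (-x) := by
  have h1 : 0 < 1 + x := by linarith
  have h2 : exp (-x) ≤ (1 + x)⁻¹ := by
    rw [exp_neg]
    exact inv_anti₀ h1 (by linarith [add_one_le_exp x])
  have h3 : x / (1 + x) = 1 - (1 + x)⁻¹ := by field_simp; ring
  linarith

theorem tsum_ofReal_exp_neg_mul_le {x : ℝ} (hx : 0 < x) :
    ∑' n : ℕ, ENNReal.ofReal (exp (-(n * x))) ≤ ENNReal.ofReal (x⁻¹ + 1) := by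
  have hlt : exp (-x) < 1 := Real.exp_lt_one_iff.2 (by linarith)
  have hs := hasSum_geometric_of_lt_one (exp_pos (-x)).le hlt
  have he : ∀ n : ℕ, exp (-(n * x)) = exp (-x) ^ n := fun n ↦ by
    rw [← exp_nat_mul]
    congr 1
    ring
  simp_rw [he]
  rw [← ENNReal.ofReal_tsum_of_nonneg (fun n ↦ by positivity) hs.summable, hs.tsum_eq]
  apply ENNReal.ofReal_le_ofReal
  have h := inv_anti₀ (by positivity) (div_one_add_le_one_sub_exp_neg hx)
  have h3 : (x / (1 + x))⁻¹ = x⁻¹ + 1 := by field_simp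
  linarith

theorem tsum_ofReal_exp_neg_mul_div_le {x : ℝ} (hx : 0 < x) :
    ∑' k : ℕ, ENNReal.ofReal (exp (-((k + 1) * x)) / (k + 1)) ≤
      ENNReal.ofReal (log x⁻¹ + x) := by
  have hlt : exp (-x) < 1 := Real.exp_lt_one_iff.2 (by linarith)
  have hs := hasSum_pow_div_log_of_abs_lt_one (x := exp (-x)) (by rwa [abs_of_pos (exp_pos _)])
  have he : ∀ k : ℕ, exp (-((k + 1) * x)) = exp (-x) ^ (k + 1) := fun k ↦ by
    rw [← exp_nat_mul]
    congr 1
    push_cast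
    ring
  simp_rw [he]
  rw [← ENNReal.ofReal_tsum_of_nonneg (fun n ↦ by positivity) hs.summable, hs.tsum_eq]
  apply ENNReal.ofReal_le_ofReal
  have h := log_le_log (by positivity) (div_one_add_le_one_sub_exp_neg hx)
  rw [log_div (by positivity) (by positivity)] at h
  have h2 := log_le_sub_one_of_pos (show 0 < 1 + x by linarith)
  rw [log_inv]
  linarith

theorem tsum_away_le {ω δ : ℝ} (hω0 : 0 < ω) (hω1 : ω < 1) (hδ : 0 < δ) (hδ1 : δ < 1) :
    (∑' x : {qp : ℤ × ℤ // qp ≠ (0, 0) ∧ 1 < |(qp.1 : ℝ) * ω - (qp.2 : ℝ)|},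
        ENNReal.ofReal (Real.exp (-((|x.1.2| + |x.1.1| : ℤ) : ℝ) * δ) /
          |(x.1.1 : ℝ) * ω - (x.1.2 : ℝ)|)) ≤
      ENNReal.ofReal (2 * ((((1 + ω) * δ)⁻¹ + 1) + (((1 - ω) * δ)⁻¹ + 1)) *
        (log δ⁻¹ + δ)) := by
  let g : Bool × Bool × ℕ × ℕ → ℝ≥0∞ := fun y ↦
    ENNReal.ofReal (exp (-(y.2.2.1 * (sideRate ω y.1 y.2.1 * δ)))) *
      ENNReal.ofReal (exp (-((y.2.2.2 + 1) * δ)) / (y.2.2.2 + 1))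
  let φ : {qp : ℤ × ℤ // qp ≠ (0, 0) ∧ 1 < |(qp.1 : ℝ) * ω - (qp.2 : ℝ)|} →
      Bool × Bool × ℕ × ℕ := fun x ↦
    (decide (0 ≤ x.1.1), decide (0 < (x.1.1 : ℝ) * ω - (x.1.2 : ℝ)),
      x.1.1.natAbs, ⌊|(x.1.1 : ℝ) * ω - (x.1.2 : ℝ)|⌋₊ - 1)
  have hφ : Function.Injective φ := fun x y hxy ↦
    Subtype.ext (injOn_lattice_code ω x.2.2 y.2.2 hxy)
  have hle : ∀ x, ENNReal.ofReal (Real.exp (-((|x.1.2| + |x.1.1| : ℤ) : ℝ) * δ) /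
      |(x.1.1 : ℝ) * ω - (x.1.2 : ℝ)|) ≤ g (φ x) := by
    rintro ⟨⟨q, p⟩, -, h⟩
    simp only [g, φ]
    rw [← ENNReal.ofReal_mul (exp_pos _).le]
    apply ENNReal.ofReal_le_ofReal
    simp only at h
    have h1 : 1 ≤ ⌊|(q : ℝ) * ω - (p : ℝ)|⌋₊ := Nat.le_floor (by exact_mod_cast h.le)
    have hk : ((⌊|(q : ℝ) * ω - (p : ℝ)|⌋₊ - 1 : ℕ) : ℝ) + 1 ≤ |(q : ℝ) * ω - (p : ℝ)| := by
      rw [Nat.cast_sub h1, Nat.cast_one, sub_add_cancel]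
      exact Nat.floor_le (abs_nonneg _)
    have hr := natAbs_mul_sideRate_add_abs_le ω q p
    rw [← mul_div_assoc, ← exp_add]
    apply div_le_div₀ (exp_pos _).le _ (by positivity) hk
    apply exp_le_exp.2
    have := mul_le_mul_of_nonneg_right ((add_le_add_right hk _).trans hr) hδ.le
    linarith
  have hlog : 0 ≤ log δ⁻¹ + δ := by
    have := log_nonneg ((one_le_inv₀ hδ).2 hδ1.le)
    linarith
  have h1 := tsum_ofReal_exp_neg_mul_le (mul_pos (show 0 < 1 + ω by linarith) hδ)
  have h2 := tsum_ofReal_exp_neg_mul_le (mul_pos (show 0 < 1 - ω by linarith) hδ)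
  have p1 : 0 ≤ ((1 + ω) * δ)⁻¹ + 1 := by positivity
  have p2 : 0 ≤ ((1 - ω) * δ)⁻¹ + 1 := by
    have : 0 < 1 - ω := by linarith
    positivity
  refine (ENNReal.tsum_le_tsum hle).trans
    ((ENNReal.tsum_comp_le_tsum_of_injective hφ g).trans ?_)
  simp only [g, ENNReal.tsum_prod', ENNReal.tsum_mul_left, ENNReal.tsum_mul_right, tsum_bool]
  simp only [← add_mul]
  rw [ENNReal.ofReal_mul (by positivity), ENNReal.ofReal_mul (by norm_num),
    ENNReal.ofReal_add p1 p2, ENNReal.ofReal_ofNat]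
  refine mul_le_mul' ?_ (tsum_ofReal_exp_neg_mul_div_le hδ)
  simp only [sideRate, if_true, Bool.true_eq_false, Bool.false_eq_true, if_false]
  calc _ ≤ _ := add_le_add (add_le_add h2 h1) (add_le_add h1 h2)
    _ = _ := by ring

/-- for irrational `ω ∈ (0,1)` and `ε > 0` there is `δ₀ > 0` such that for all
`δ ∈ (0,δ₀)` the sum of `L(q,p) = e^{-(|p|+|q|)δ}/|qω-p|` over
`Away = {(q,p) ≠ (0,0) : |qω-p| > 1}` is at most `(4/(1+ω) + 2/(1-ω) + ε) δ⁻¹ log δ⁻¹`. -/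
theorem away_sum_bound (ω : ℝ) (hirr : Irrational ω) (hω0 : 0 < ω) (hω1 : ω < 1)
    (ε : ℝ) (hε : 0 < ε) :
    ∃ δ₀ : ℝ, 0 < δ₀ ∧ ∀ δ : ℝ, 0 < δ → δ < δ₀ →
      (∑' x : {qp : ℤ × ℤ // qp ≠ (0, 0) ∧ 1 < |(qp.1 : ℝ) * ω - (qp.2 : ℝ)|},
          ENNReal.ofReal
            (Real.exp (-((|x.1.2| + |x.1.1| : ℤ) : ℝ) * δ) /
              |(x.1.1 : ℝ) * ω - (x.1.2 : ℝ)|)) ≤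
        ENNReal.ofReal ((4 / (1 + ω) + 2 / (1 - ω) + ε) * δ⁻¹ * Real.log δ⁻¹) := by
  set A : ℝ := 2 / (1 + ω) + 2 / (1 - ω) with hA
  have hp : 0 < 1 + ω := by linarith
  have hm : 0 < 1 - ω := by linarith
  have hApos : 0 < A := by positivity
  refine ⟨min (exp (-1)) (min (1 / 8) (1 / (2 * (A + 1)))), by positivity, fun δ hδ hlt ↦ ?_⟩
  obtain ⟨hexp, hlt'⟩ := lt_min_iff.1 hlt
  obtain ⟨h8, hAδ⟩ := lt_min_iff.1 hlt'
  refine (tsum_away_le hω0 hω1 hδ (by linarith)).trans (ENNReal.ofReal_le_ofReal ?_)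
  have hl : 1 ≤ log δ⁻¹ := by
    have := log_le_log hδ hexp.le
    rw [log_exp] at this
    rw [log_inv]
    linarith
  set l := log δ⁻¹
  have hd8 : 8 ≤ δ⁻¹ := by
    rw [le_inv_comm₀ (by norm_num) hδ]
    linarith
  have hdA : 2 * (A + 1) ≤ δ⁻¹ := by
    rw [le_inv_comm₀ (by positivity) hδ, ← one_div]
    exact hAδ.le
  have hone : 1 ≤ 2 / (1 + ω) := by
    rw [le_div_iff₀ hp]
    linarith
  have hlhs : 2 * ((((1 + ω) * δ)⁻¹ + 1) + (((1 - ω) * δ)⁻¹ + 1)) * (l + δ) =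
      A * δ⁻¹ * l + A + 4 * l + 4 * δ := by
    rw [hA]
    field_simp
    ring
  have hcoef : A + 1 ≤ 4 / (1 + ω) + 2 / (1 - ω) + ε := by
    have : 4 / (1 + ω) = 2 / (1 + ω) + 2 / (1 + ω) := by ring
    rw [this, hA]
    linarith
  have hdl : 0 ≤ δ⁻¹ * l := by positivity
  have hmain := mul_le_mul_of_nonneg_right hcoef hdl
  have e1 : 8 * l ≤ δ⁻¹ * l := mul_le_mul_of_nonneg_right hd8 (by linarith)
  have e2 : 2 * (A + 1) ≤ δ⁻¹ * l := hdA.trans (le_mul_of_one_le_right (by positivity) hl)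
  rw [hlhs]
  linarith
end

section
/- For all ℓ > 0 and Δ > 0: Σ_{n=1}^∞ e^{ℓ(n+1) − e^{ℓn} Δ} ≤ e^ℓ ( e^{−1} + ℓ^{−1} ) Δ^{−1}. -/
open Real
open scoped ENNReal

theorem mul_exp_neg_le_of_le_one {x y : ℝ} (hxy : x ≤ y) (hy₀ : 0 ≤ y) (hy : y ≤ 1) :
    x * exp (-x) ≤ y * exp (-y) := by
  have h : exp (-y) = exp (-(y - x)) * exp (-x) := by rw [← exp_add]; ring_nf
  have h₁ := add_one_le_exp (-(y - x))
  rw [h, ← mul_assoc]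
  refine mul_le_mul_of_nonneg_right ?_ (exp_pos _).le
  nlinarith [mul_le_mul_of_nonneg_left h₁ hy₀, mul_nonneg (sub_nonneg.2 hxy) (sub_nonneg.2 hy)]

theorem mul_exp_neg_le_of_one_le {x y : ℝ} (hxy : x ≤ y) (hx : 1 ≤ x) :
    y * exp (-y) ≤ x * exp (-x) := by
  have h : exp (-x) = exp (y - x) * exp (-y) := by rw [← exp_add]; ring_nf
  have h₁ := add_one_le_exp (y - x)
  rw [h, ← mul_assoc]
  refine mul_le_mul_of_nonneg_right ?_ (exp_pos _).le
  nlinarith [mul_le_mul_of_nonneg_left h₁ (zero_le_one.trans hx),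
    mul_nonneg (sub_nonneg.2 hxy) (sub_nonneg.2 hx)]

theorem mul_exp_neg_le_min {y : ℝ} : y * exp (-y) ≤ min y 1 * exp (-min y 1) := by
  rcases le_total y 1 with h | h
  · rw [min_eq_left h]
  · rw [min_eq_right h]
    exact mul_exp_neg_le_of_one_le h le_rfl

/-- On an interval, `x ↦ x * exp (-x)` is at least its value at the right endpoint, minus the
increment of its running maximum `x ↦ min x 1 * exp (-min x 1)`. -/
theorem mul_exp_neg_add_min_le {x y z : ℝ} (hx : 0 ≤ x) (hxy : x ≤ y) (hyz : y ≤ z) :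
    z * exp (-z) + min x 1 * exp (-min x 1) ≤ y * exp (-y) + min z 1 * exp (-min z 1) := by
  rcases le_total y 1 with h | h
  · rw [min_eq_left (hxy.trans h)]
    linarith [mul_exp_neg_le_of_le_one hxy (hx.trans hxy) h, mul_exp_neg_le_min (y := z)]
  · have h₁ : min x 1 * exp (-min x 1) ≤ min z 1 * exp (-min z 1) :=
      mul_exp_neg_le_of_le_one (min_le_min_right 1 (hxy.trans hyz))
        (le_min (hx.trans (hxy.trans hyz)) zero_le_one) (min_le_right _ _)
    linarith [mul_exp_neg_le_of_one_le hyz h]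

theorem sub_mul_mul_exp_neg_le {a b Δ : ℝ} (hab : a < b) (hΔ : 0 < Δ) :
    (b - a) * (exp b * Δ * exp (-(exp b * Δ)) +
        min (exp a * Δ) 1 * exp (-min (exp a * Δ) 1)) ≤
      exp (-(exp a * Δ)) - exp (-(exp b * Δ)) +
        (b - a) * (min (exp b * Δ) 1 * exp (-min (exp b * Δ) 1)) := by
  have hd : ∀ t : ℝ, HasDerivAt (fun t => -exp (-(exp t * Δ)))
      (exp t * Δ * exp (-(exp t * Δ))) t := fun t =>
    ((((hasDerivAt_exp t).mul_const Δ).fun_neg.exp).fun_neg).congr_deriv (by ring)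
  obtain ⟨c, hc, h⟩ := exists_hasDerivAt_eq_slope _ _ hab
    (fun t _ => (hd t).continuousAt.continuousWithinAt) (fun t _ => hd t)
  have hpos : 0 < b - a := sub_pos.2 hab
  rw [eq_div_iff hpos.ne'] at h
  have hmin := mul_exp_neg_add_min_le (mul_pos (exp_pos a) hΔ).le
    (mul_le_mul_of_nonneg_right (exp_le_exp.2 hc.1.le) hΔ.le)
    (mul_le_mul_of_nonneg_right (exp_le_exp.2 hc.2.le) hΔ.le)
  nlinarith [mul_le_mul_of_nonneg_left hmin hpos.le]

theorem sum_range_mul_exp_neg_le {ℓ Δ : ℝ} (hℓ : 0 < ℓ) (hΔ : 0 < Δ) (N : ℕ) :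
    ℓ * ∑ n ∈ Finset.range (N + 1),
        exp (ℓ * (n + 1)) * Δ * exp (-(exp (ℓ * (n + 1)) * Δ)) ≤
      1 - exp (-(exp (ℓ * (N + 1)) * Δ)) +
        ℓ * (min (exp (ℓ * (N + 1)) * Δ) 1 * exp (-min (exp (ℓ * (N + 1)) * Δ) 1)) := by
  induction N with
  | zero =>
    have h₁ : exp (-(exp (ℓ * ((0 : ℕ) + 1)) * Δ)) ≤ 1 := exp_le_one_iff.2 (by
      have := mul_pos (exp_pos (ℓ * ((0 : ℕ) + 1))) hΔ
      linarith)
    have h₂ := mul_le_mul_of_nonneg_left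
      (mul_exp_neg_le_min (y := exp (ℓ * ((0 : ℕ) + 1)) * Δ)) hℓ.le
    rw [zero_add, Finset.sum_range_one]
    linarith
  | succ N ih =>
    have h := sub_mul_mul_exp_neg_le (a := ℓ * (N + 1)) (b := ℓ * ((N + 1 : ℕ) + 1)) (Δ := Δ)
      (by push_cast; nlinarith) hΔ
    have hs : ℓ * ((N + 1 : ℕ) + 1) - ℓ * (N + 1) = ℓ := by push_cast; ring
    rw [hs] at h
    rw [Finset.sum_range_succ]
    linarith

/-- for all `ℓ > 0` and `Δ > 0`:
`Σ_{n=1}^∞ e^{ℓ(n+1) - e^{ℓn} Δ} ≤ e^ℓ (e⁻¹ + ℓ⁻¹) Δ⁻¹`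
(the ideal estimate of the first Brjuno-like function when `q_n = e^{ℓn}`). -/
theorem ideal_brj1_bound (ℓ Δ : ℝ) (hℓ : 0 < ℓ) (hΔ : 0 < Δ) :
    (∑' n : ℕ, ENNReal.ofReal
        (Real.exp (ℓ * ((n : ℝ) + 2) - Real.exp (ℓ * ((n : ℝ) + 1)) * Δ))) ≤
      ENNReal.ofReal (Real.exp ℓ * (Real.exp (-1) + ℓ⁻¹) * Δ⁻¹) := by
  refine ENNReal.tsum_le_of_sum_range_le fun N => ?_
  refine (Finset.sum_le_sum_of_subset (Finset.range_mono N.le_succ)).trans ?_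
  rw [← ENNReal.ofReal_sum_of_nonneg fun _ _ => (exp_pos _).le]
  refine ENNReal.ofReal_le_ofReal ?_
  have hterm : ∀ n : ℕ, exp (ℓ * ((n : ℝ) + 2) - exp (ℓ * ((n : ℝ) + 1)) * Δ) =
      exp ℓ * Δ⁻¹ * (exp (ℓ * (n + 1)) * Δ * exp (-(exp (ℓ * (n + 1)) * Δ))) := fun n => by
    rw [show ℓ * ((n : ℝ) + 2) - exp (ℓ * ((n : ℝ) + 1)) * Δ =
      ℓ + ℓ * (n + 1) + -(exp (ℓ * (n + 1)) * Δ) by ring, exp_add, exp_add]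
    field_simp
  simp only [hterm]
  rw [← Finset.mul_sum, mul_right_comm _ (exp (-1) + ℓ⁻¹)]
  refine mul_le_mul_of_nonneg_left ?_ (mul_pos (exp_pos _) (inv_pos.2 hΔ)).le
  have hsum := sum_range_mul_exp_neg_le hℓ hΔ N
  have hmax : min (exp (ℓ * (N + 1)) * Δ) 1 * exp (-min (exp (ℓ * (N + 1)) * Δ) 1) ≤
      1 * exp (-1) :=
    mul_exp_neg_le_of_le_one (min_le_right _ _) zero_le_one le_rfl
  have hexp := exp_pos (-(exp (ℓ * (N + 1)) * Δ))
  refine le_of_mul_le_mul_left ?_ hℓ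
  rw [mul_add, mul_inv_cancel₀ hℓ.ne']
  linarith [mul_le_mul_of_nonneg_left hmax hℓ.le]
end

section
/- Let ω ∈ (0,1) be irrational and suppose Σ_{n=1}^∞ (log q_{n+1})/q_n < ∞ (i.e. ω is a Brjuno number). Then for every Δ > 0 both Σ_{n=1}^∞ e^{−q_n Δ} q_{n+1} < ∞ and Σ_{n=1}^∞ e^{−2 q_n Δ} q_{n+1} log a_{n+1} < ∞ (i.e. ω is a semi-Brjuno number). -/
open Real
open scoped ENNReal

lemma cfX_irrational_mem_Ioo {ω : ℝ} (hirr : Irrational ω) (hω0 : 0 < ω) (hω1 : ω < 1) (n : ℕ) :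
    Irrational (cfX ω n) ∧ 0 < cfX ω n ∧ cfX ω n < 1 := by
  induction n with
  | zero => exact ⟨hirr, hω0, hω1⟩
  | succ n ih =>
    have h : Irrational (cfX ω (n + 1)) := ih.1.inv.sub_intCast ⌊(cfX ω n)⁻¹⌋
    exact ⟨h, lt_of_le_of_ne (Int.fract_nonneg _) h.ne_zero.symm, Int.fract_lt_one _⟩

lemma one_le_cfA_succ {ω : ℝ} (hirr : Irrational ω) (hω0 : 0 < ω) (hω1 : ω < 1) (n : ℕ) :
    1 ≤ cfA ω (n + 1) := by
  obtain ⟨-, h0, h1⟩ := cfX_irrational_mem_Ioo hirr hω0 hω1 n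
  have h : (1 : ℤ) ≤ ⌊(cfX ω n)⁻¹⌋ :=
    Int.le_floor.2 (by exact_mod_cast (one_lt_inv₀ h0).2 h1 |>.le)
  rw [cfA]
  omega

lemma cfQ_pos {ω : ℝ} (hirr : Irrational ω) (hω0 : 0 < ω) (hω1 : ω < 1) :
    ∀ n, 0 < cfQ ω n
  | 0 => Nat.one_pos
  | 1 => one_le_cfA_succ hirr hω0 hω1 0
  | n + 2 => Nat.add_pos_right _ (cfQ_pos hirr hω0 hω1 n)

lemma le_cfQ {ω : ℝ} (hirr : Irrational ω) (hω0 : 0 < ω) (hω1 : ω < 1) (n : ℕ) :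
    n ≤ cfQ ω n := by
  induction n with
  | zero => exact Nat.zero_le _
  | succ n ih =>
    cases n with
    | zero => exact cfQ_pos hirr hω0 hω1 1
    | succ n =>
      have ha := one_le_cfA_succ hirr hω0 hω1 (n + 1)
      have hq := cfQ_pos hirr hω0 hω1 n
      rw [cfQ]
      nlinarith

lemma cfA_le_cfQ {ω : ℝ} (hirr : Irrational ω) (hω0 : 0 < ω) (hω1 : ω < 1) (n : ℕ) :
    cfA ω (n + 2) ≤ cfQ ω (n + 2) := by
  rw [cfQ]
  exact (Nat.le_mul_of_pos_right _ (cfQ_pos hirr hω0 hω1 (n + 1))).trans (Nat.le_add_right _ _)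

/-- Along a Brjuno number, `q_{n+1}` is eventually below every exponential in `q_n`. -/
lemma eventually_cfQ_le_exp {ω : ℝ} (hirr : Irrational ω) (hω0 : 0 < ω) (hω1 : ω < 1)
    (hbrjuno : (∑' n : ℕ,
        ENNReal.ofReal (Real.log (cfQ ω (n + 2) : ℝ) / (cfQ ω (n + 1) : ℝ))) ≠ ⊤)
    {ε : ℝ} (hε : 0 < ε) :
    ∀ᶠ n in Filter.atTop, (cfQ ω (n + 2) : ℝ) ≤ Real.exp (cfQ ω (n + 1) * ε) := by
  have ht := ENNReal.tendsto_atTop_zero_of_tsum_ne_top hbrjuno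
  filter_upwards [ht.eventually_lt_const (ENNReal.ofReal_pos.2 hε)] with n hn
  have h1 : (0 : ℝ) < cfQ ω (n + 1) := by exact_mod_cast cfQ_pos hirr hω0 hω1 (n + 1)
  have h2 : (0 : ℝ) < cfQ ω (n + 2) := by exact_mod_cast cfQ_pos hirr hω0 hω1 (n + 2)
  have h := ((ENNReal.ofReal_lt_ofReal_iff hε).1 hn).le
  rw [div_le_iff₀ h1] at h
  rw [← Real.log_le_iff_le_exp h2]
  linarith

lemma tsum_ofReal_ne_top_of_eventually_le_exp {f : ℕ → ℝ} {ε : ℝ} (hε : 0 < ε)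
    (hf0 : ∀ n, 0 ≤ f n) (hf : ∀ᶠ n in Filter.atTop, f n ≤ Real.exp (n * -ε)) :
    ∑' n, ENNReal.ofReal (f n) ≠ ⊤ := by
  refine Summable.tsum_ofReal_ne_top ?_
  refine (Real.summable_exp_nat_mul_iff.2 (neg_lt_zero.2 hε)).of_norm_bounded_eventually_nat ?_
  simpa only [Real.norm_of_nonneg (hf0 _)] using hf

/-- Brjuno numbers are semi-Brjuno. If `Σ_{n=1}^∞ (log q_{n+1})/q_n < ∞` then
for every `Δ > 0` both `Σ_{n=1}^∞ e^{-q_n Δ} q_{n+1} < ∞` and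
`Σ_{n=1}^∞ e^{-2q_n Δ} q_{n+1} log a_{n+1} < ∞`. -/
theorem brjuno_is_semiBrjuno (ω : ℝ) (hirr : Irrational ω) (hω0 : 0 < ω) (hω1 : ω < 1)
    (hbrjuno : (∑' n : ℕ,
        ENNReal.ofReal (Real.log (cfQ ω (n + 2) : ℝ) / (cfQ ω (n + 1) : ℝ))) ≠ ⊤) :
    ∀ Δ : ℝ, 0 < Δ →
      (∑' n : ℕ, ENNReal.ofReal
          (Real.exp (-(cfQ ω (n + 1) : ℝ) * Δ) * (cfQ ω (n + 2) : ℝ))) ≠ ⊤ ∧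
      (∑' n : ℕ, ENNReal.ofReal
          (Real.exp (-2 * (cfQ ω (n + 1) : ℝ) * Δ) * (cfQ ω (n + 2) : ℝ) *
            Real.log (cfA ω (n + 2) : ℝ))) ≠ ⊤ := by
  intro Δ hΔ
  have hbound := eventually_cfQ_le_exp hirr hω0 hω1 hbrjuno (half_pos hΔ)
  have hn_le (n : ℕ) : (n : ℝ) ≤ cfQ ω (n + 1) := by
    exact_mod_cast (Nat.le_succ n).trans (le_cfQ hirr hω0 hω1 (n + 1))
  constructor
  · refine tsum_ofReal_ne_top_of_eventually_le_exp (half_pos hΔ) (fun n => by positivity) ?_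
    filter_upwards [hbound] with n hn
    calc
      _ ≤ Real.exp (-(cfQ ω (n + 1) : ℝ) * Δ) * Real.exp (cfQ ω (n + 1) * (Δ / 2)) := by gcongr
      _ = Real.exp (cfQ ω (n + 1) * -(Δ / 2)) := by
        rw [← Real.exp_add]
        ring_nf
      _ ≤ _ := Real.exp_le_exp.2 (mul_le_mul_of_nonpos_right (hn_le n) (by linarith))
  · refine tsum_ofReal_ne_top_of_eventually_le_exp hΔ
      (fun n => mul_nonneg (by positivity) (Real.log_natCast_nonneg _)) ?_
    filter_upwards [hbound] with n hn
    have hlog : Real.log (cfA ω (n + 2) : ℝ) ≤ Real.exp (cfQ ω (n + 1) * (Δ / 2)) :=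
      (Real.log_le_self (Nat.cast_nonneg _)).trans <|
        (Nat.cast_le.2 (cfA_le_cfQ hirr hω0 hω1 n)).trans hn
    calc
      _ ≤ Real.exp (-2 * (cfQ ω (n + 1) : ℝ) * Δ) * Real.exp (cfQ ω (n + 1) * (Δ / 2)) *
          Real.exp (cfQ ω (n + 1) * (Δ / 2)) := by gcongr
      _ = Real.exp (cfQ ω (n + 1) * -Δ) := by
        rw [← Real.exp_add, ← Real.exp_add]
        ring_nf
      _ ≤ _ := Real.exp_le_exp.2 (mul_le_mul_of_nonpos_right (hn_le n) (by linarith))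
end
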